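/- Main Theorem (equivalence of denotational and game semantics of pLμ on arbitrary models): For every PLTS ⟨P, {→a}_{a∈L}⟩ of arbitrary cardinality, every pLμ formula F in normal form, every interpretation ρ : Var → (P → [0,1]) and every process state p ∈ P, the equalities ⟦F⟧ρ(p) = Val↓(𝒢^F_ρ)(⟨p,F⟩) = Val↑(𝒢^F_ρ)(⟨p,F⟩) hold; in particular the pLμ game 𝒢^F_ρ is determined at every state ⟨p,F⟩. -/

import Mathlib

noncomputable section

open scoped unitInterval Classical

instance : Fact ((0:ℝ) ≤ 1) := ⟨zero_le_one⟩

/-- A discrete probability distribution on `X`: a `[0,1]`-valued (indeed nonnegative)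
function summing to `1` (hence with countable support). -/
structure PDist (X : Type) where
  f : X → ℝ
  nonneg : ∀ x, 0 ≤ f x
  sum_one : HasSum f 1

/-- A probabilistic labeled transition system over labels `L` with states `P`:
for each label `a` and state `p`, the set of distributions `d` with `p →a d`. -/
structure PLTS (L P : Type) where
  trans : L → P → Set (PDist P)

/-- Formulas of the probabilistic modal μ-calculus, with variables drawn from `ℕ`. -/
inductive pLmu (L : Type) : Type
  | var : ℕ → pLmu L
  | dia : L → pLmu L → pLmu L
  | box : L → pLmu L → pLmu L
  | or  : pLmu L → pLmu L → pLmu L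
  | and : pLmu L → pLmu L → pLmu L
  | mu  : ℕ → pLmu L → pLmu L
  | nu  : ℕ → pLmu L → pLmu L

namespace pLmu

variable {L P : Type}

/-- free variables -/
def freeVars : pLmu L → Set ℕ
  | .var X => {X}
  | .dia _ G => freeVars G
  | .box _ G => freeVars G
  | .or G H => freeVars G ∪ freeVars H
  | .and G H => freeVars G ∪ freeVars H
  | .mu X G => freeVars G \ {X}
  | .nu X G => freeVars G \ {X}

/-- the list of variables bound by the μ- and ν-binders occurring in a formula -/
def binders : pLmu L → List ℕ
  | .var _ => []
  | .dia _ G => binders G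
  | .box _ G => binders G
  | .or G H => binders G ++ binders H
  | .and G H => binders G ++ binders H
  | .mu X G => X :: binders G
  | .nu X G => X :: binders G

/-- A formula is in normal form if every binder binds a distinct variable and no
variable occurs both free and bound. -/
def NormalForm (F : pLmu L) : Prop :=
  F.binders.Nodup ∧ ∀ X ∈ F.binders, X ∉ F.freeVars

/-- A formula is closed if it has no free variables. -/
def Closed (F : pLmu L) : Prop := F.freeVars = ∅

/-- The expected value of `g : P → [0,1]` under a distribution `d` on `P`
(the real number `∑ q, d(q) · g(q)`, which lies in `[0,1]`, viewed in `[0,1]`). -/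
def distExp (d : PDist P) (g : P → unitInterval) : unitInterval :=
  Set.projIcc 0 1 zero_le_one (∑' q, d.f q * (g q : ℝ))

/-- The denotational semantics `⟦F⟧ρ : P → [0,1]` of a pLμ formula, where least
(resp. greatest) fixed points are given, à la Knaster–Tarski, as the infimum of
prefixed points (resp. supremum of postfixed points) in the complete lattice `P → [0,1]`. -/
def sem (M : PLTS L P) : pLmu L → (ℕ → P → unitInterval) → P → unitInterval
  | .var X, ρ, p => ρ X p
  | .dia a G, ρ, p => sSup ((fun d => distExp d (sem M G ρ)) '' M.trans a p)
  | .box a G, ρ, p => sInf ((fun d => distExp d (sem M G ρ)) '' M.trans a p)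
  | .or G H, ρ, p => sem M G ρ p ⊔ sem M H ρ p
  | .and G H, ρ, p => sem M G ρ p ⊓ sem M H ρ p
  | .mu X G, ρ, p => sInf {g : P → unitInterval | sem M G (Function.update ρ X g) ≤ g} p
  | .nu X G, ρ, p => sSup {g : P → unitInterval | g ≤ sem M G (Function.update ρ X g)} p

end pLmu

noncomputable section

open scoped unitInterval Classical

/-- The three agents of a 2½-player game. -/
inductive Player : Type
  | one : Player
  | two : Player
  | nature : Player
deriving DecidableEq

/-- A 2½-player arena: a directed graph `(S, E)`, an assignment of states to the
players (Player 1, Player 2, Nature), and probabilistic transition data at Nature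
states. -/
structure Arena (S : Type) where
  E : S → Set S
  owner : S → Player
  prob : S → S → ℝ

namespace Arena

variable {S : Type}

/-- Well-formedness: at every Nature state `s`, `prob s` is a probability
distribution whose support is exactly the set `E s` of successors of `s`. -/
def Wellformed (A : Arena S) : Prop :=
  ∀ s, A.owner s = Player.nature →
    (∀ t, 0 ≤ A.prob s t) ∧ HasSum (A.prob s) 1 ∧ A.E s = Function.support (A.prob s)

/-- `s` is a terminal state if it has no successors. -/
def Terminal (A : Arena S) (s : S) : Prop := A.E s = ∅

end Arena

/-- An (unbounded memory deterministic) strategy for player `pl` in arena `A`: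
given the history `hist` and the current state `s` (a non-terminal state owned by
`pl`), it picks a successor of `s`. -/
structure Strategy {S : Type} (A : Arena S) (pl : Player) where
  next : List S → S → S
  valid : ∀ (hist : List S) (s : S), A.owner s = pl → A.E s ≠ ∅ → next hist s ∈ A.E s

variable {S : Type}

/-- The Markov chain determined by a strategy profile `(σ1, σ2)` and initial state
`s0`: the tree of finite paths from `s0` in which nodes ending in a Player 1
(resp. Player 2) state are extended uniquely according to `σ1` (resp. `σ2`), nodes
ending in a Nature state branch fully over the successors, and (for the purpose of
encoding finite completed paths as infinite sequences) nodes ending in a terminal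
state are extended by repeating the terminal state. -/
inductive MC (A : Arena S) (σ1 : Strategy A Player.one) (σ2 : Strategy A Player.two)
    (s0 : S) : List S → Prop
  | root : MC A σ1 σ2 s0 [s0]
  | one (l : List S) (s : S) : MC A σ1 σ2 s0 (l ++ [s]) → A.owner s = Player.one →
      A.E s ≠ ∅ → MC A σ1 σ2 s0 (l ++ [s, σ1.next l s])
  | two (l : List S) (s : S) : MC A σ1 σ2 s0 (l ++ [s]) → A.owner s = Player.two →
      A.E s ≠ ∅ → MC A σ1 σ2 s0 (l ++ [s, σ2.next l s])
  | nature (l : List S) (s t : S) : MC A σ1 σ2 s0 (l ++ [s]) →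
      A.owner s = Player.nature → t ∈ A.E s → MC A σ1 σ2 s0 (l ++ [s, t])
  | term (l : List S) (s : S) : MC A σ1 σ2 s0 (l ++ [s]) → A.E s = ∅ →
      MC A σ1 σ2 s0 (l ++ [s, s])

/-- The space of completed paths, encoded as infinite sequences of states
(a finite completed path, i.e. one ending in a terminal state, is encoded by
repeating its terminal state forever). -/
def PathSpace (S : Type) : Type := ℕ → S

instance : MeasurableSpace (PathSpace S) :=
  @MeasurableSpace.pi ℕ (fun _ => S) (fun _ => ⊤)

/-- The basic cylinder set of completed paths extending a finite path. -/
def cyl (l : List S) : Set (PathSpace S) :=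
  {u | ∀ i : Fin l.length, u i = l.get i}

/-- the probability of a single step -/
def stepProb (A : Arena S) (s t : S) : ℝ :=
  if A.owner s = Player.nature then A.prob s t else 1

/-- The product of the probabilities of the Nature steps along a finite path. -/
def pathProb (A : Arena S) : List S → ℝ
  | [] => 1
  | [_] => 1
  | s :: t :: l => stepProb A s t * pathProb A (t :: l)

/-- The weight assigned to a basic cylinder: the product of the probabilities of its
Nature steps if the underlying finite path belongs to the Markov chain, `0` otherwise. -/
def cylWeight (A : Arena S) (σ1 : Strategy A Player.one) (σ2 : Strategy A Player.two)
    (s0 : S) (l : List S) : ℝ :=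
  if MC A σ1 σ2 s0 l then pathProb A l else 0

/-- The Borel probability measure on completed paths induced by the Markov chain
`M^{s0}_{σ1,σ2}`: the unique probability measure assigning to every basic cylinder
its weight. -/
def pathMeasure (A : Arena S) (σ1 : Strategy A Player.one) (σ2 : Strategy A Player.two)
    (s0 : S) : MeasureTheory.Measure (PathSpace S) :=
  if h : ∃ μ : MeasureTheory.Measure (PathSpace S), MeasureTheory.IsProbabilityMeasure μ ∧
      ∀ l : List S, l ≠ [] → μ (cyl l) = ENNReal.ofReal (cylWeight A σ1 σ2 s0 l)
  then h.choose else 0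

/-- The payoff function induced by a parity structure `(pri, R)`: a completed path
reaching a terminal state gets the reward `R` of (the first occurrence of) that
terminal state; an infinite path gets `1` if the greatest priority occurring
infinitely often along it is even, and `0` otherwise. -/
def payoff (A : Arena S) (pri : S → ℕ) (R : S → ℝ) (u : PathSpace S) : ℝ :=
  if h : ∃ i, A.E (u i) = ∅ then R (u (Nat.find h))
  else if Even (sSup {n | {i | pri (u i) = n}.Infinite}) then 1 else 0

/-- The expected reward of Player 1 for the Markov chain `M^{s0}_{σ1,σ2}`:
the integral of the payoff against the induced probability measure on paths. -/
def expReward (A : Arena S) (pri : S → ℕ) (R : S → ℝ) (σ1 : Strategy A Player.one)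
    (σ2 : Strategy A Player.two) (s0 : S) : ℝ :=
  ∫ u, payoff A pri R u ∂(pathMeasure A σ1 σ2 s0)

/-- The lower value `Val↓` of the 2½-player parity game `⟨A, Φ_(pri,R)⟩`. -/
def lowerValue (A : Arena S) (pri : S → ℕ) (R : S → ℝ) (s : S) : ℝ :=
  ⨆ σ1 : Strategy A Player.one, ⨅ σ2 : Strategy A Player.two, expReward A pri R σ1 σ2 s

/-- The upper value `Val↑` of the 2½-player parity game `⟨A, Φ_(pri,R)⟩`. -/
def upperValue (A : Arena S) (pri : S → ℕ) (R : S → ℝ) (s : S) : ℝ :=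
  ⨅ σ2 : Strategy A Player.two, ⨆ σ1 : Strategy A Player.one, expReward A pri R σ1 σ2 s

/-- The Bellman functional `𝓕` on `S → ℝ` associated to the game `⟨A, Φ_(pri,R)⟩`. -/
def bellman (A : Arena S) (R : S → ℝ) (f : S → ℝ) : S → ℝ := fun s =>
  if A.E s = ∅ then R s
  else match A.owner s with
    | Player.one => sSup (f '' A.E s)
    | Player.two => sInf (f '' A.E s)
    | Player.nature => ∑' t : A.E s, A.prob s t * f t
namespace pLmu

variable {L P : Type}

/-- the number of connectives of a formula -/
def size : pLmu L → ℕ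
  | .var _ => 1
  | .dia _ G => size G + 1
  | .box _ G => size G + 1
  | .or G H => size G + size H + 1
  | .and G H => size G + size H + 1
  | .mu _ G => size G + 1
  | .nu _ G => size G + 1

/-- `varInfo F d X` looks up the (leftmost outermost) binder binding `X` in `F`,
returning `some (d', b)` where `d'` is the depth (starting from `d`) at which the
binder occurs and `b` is `true` for a μ-binder and `false` for a ν-binder, and
`none` if `X` is not bound in `F`. -/
def varInfo : pLmu L → ℕ → ℕ → Option (ℕ × Bool)
  | .var _, _, _ => none
  | .dia _ G, d, X => varInfo G (d+1) X
  | .box _ G, d, X => varInfo G (d+1) X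
  | .or G H, d, X => (varInfo G (d+1) X).orElse (fun _ => varInfo H (d+1) X)
  | .and G H, d, X => (varInfo G (d+1) X).orElse (fun _ => varInfo H (d+1) X)
  | .mu Y G, d, X => if Y = X then some (d, true) else varInfo G (d+1) X
  | .nu Y G, d, X => if Y = X then some (d, false) else varInfo G (d+1) X

/-- `bodyOf F X` is the body of the (leftmost outermost) binder binding `X` in `F`,
if any. -/
def bodyOf : pLmu L → ℕ → Option (pLmu L)
  | .var _, _ => none
  | .dia _ G, X => bodyOf G X
  | .box _ G, X => bodyOf G X
  | .or G H, X => (bodyOf G X).orElse (fun _ => bodyOf H X)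
  | .and G H, X => (bodyOf G X).orElse (fun _ => bodyOf H X)
  | .mu Y G, X => if Y = X then some G else bodyOf G X
  | .nu Y G, X => if Y = X then some G else bodyOf G X

end pLmu

/-- The states of the game `𝒢^F_ρ`: pairs of a process state or a distribution on
process states, and a (sub)formula. -/
abbrev GState (L P : Type) : Type := (P ⊕ PDist P) × pLmu L

/-- The arena of the 2½-player parity game `𝒢^F_ρ` associated to a PLTS `M`
and a formula `F`. -/
def gameArena (M : PLTS L P) (F : pLmu L) : Arena (GState L P) where
  E := fun s =>
    match s with
    | (Sum.inl p, .var X) =>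
        match pLmu.bodyOf F X with
        | some H => {((Sum.inl p : P ⊕ PDist P), H)}
        | none => ∅
    | (Sum.inl p, .dia a G) => (fun d => ((Sum.inr d : P ⊕ PDist P), G)) '' M.trans a p
    | (Sum.inl p, .box a G) => (fun d => ((Sum.inr d : P ⊕ PDist P), G)) '' M.trans a p
    | (Sum.inl p, .or G H) => {((Sum.inl p : P ⊕ PDist P), G), ((Sum.inl p : P ⊕ PDist P), H)}
    | (Sum.inl p, .and G H) => {((Sum.inl p : P ⊕ PDist P), G), ((Sum.inl p : P ⊕ PDist P), H)}
    | (Sum.inl p, .mu _ G) => {((Sum.inl p : P ⊕ PDist P), G)}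
    | (Sum.inl p, .nu _ G) => {((Sum.inl p : P ⊕ PDist P), G)}
    | (Sum.inr d, G) => (fun q => ((Sum.inl q : P ⊕ PDist P), G)) '' Function.support d.f
  owner := fun s =>
    match s with
    | (Sum.inl _, .var X) =>
        match pLmu.varInfo F 0 X with
        | some (_, true) => Player.one
        | some (_, false) => Player.two
        | none => Player.one
    | (Sum.inl _, .dia _ _) => Player.one
    | (Sum.inl _, .box _ _) => Player.two
    | (Sum.inl _, .or _ _) => Player.one
    | (Sum.inl _, .and _ _) => Player.two
    | (Sum.inl _, .mu _ _) => Player.one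
    | (Sum.inl _, .nu _ _) => Player.two
    | (Sum.inr _, _) => Player.nature
  prob := fun s t =>
    match s, t with
    | (Sum.inr d, G), (Sum.inl q, G') => if G' = G then d.f q else 0
    | _, _ => 0

/-- The priority assignment of the game `𝒢^F_ρ`: a state `⟨p, X⟩` with `X` bound
in `F` at binder depth `d` gets the positive priority `2(|F| - d) + 1` if `X` is a
μ-variable and `2(|F| - d)` if `X` is a ν-variable (so that μ-variables get odd and
ν-variables get even priorities, and variables subsuming others get greater
priorities); all other states get priority `0`. -/
def gamePri (F : pLmu L) : GState L P → ℕ := fun s =>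
  match s with
  | (Sum.inl _, .var X) =>
      match pLmu.varInfo F 0 X with
      | some (d, true) => 2 * (F.size - d) + 1
      | some (d, false) => 2 * (F.size - d)
      | none => 0
  | _ => 0

/-- The terminal reward assignment of the game `𝒢^F_ρ`: a terminal state `⟨p, X⟩`
(with `X` free in `F`) gets reward `ρ(X)(p)`; a terminal state `⟨p, ⟨a⟩G⟩` gets
reward `0` and a terminal state `⟨p, [a]G⟩` gets reward `1`. -/
def gameR (F : pLmu L) (ρ : ℕ → P → unitInterval) : GState L P → ℝ := fun s =>
  match s with
  | (Sum.inl p, .var X) => (ρ X p : ℝ)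
  | (Sum.inl _, .dia _ _) => 0
  | (Sum.inl _, .box _ _) => 1
  | _ => 0


namespace PL
open MeasureTheory ProbabilityTheory
open scoped ENNReal
variable {S : Type}

/-- prepend a state to a path -/
def consP (s : S) (u : PathSpace S) : PathSpace S
  | 0 => s
  | (n+1) => u n

@[simp] lemma consP_zero (s : S) (u : PathSpace S) : consP s u 0 = s := rfl
@[simp] lemma consP_succ (s : S) (u : PathSpace S) (n : ℕ) : consP s u (n+1) = u n := rfl

lemma meas_eval (i : ℕ) (A : Set S) : MeasurableSet {u : PathSpace S | u i ∈ A} := by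
  have h : @Measurable (PathSpace S) S _ ⊤ (fun u => u i) :=
    @measurable_pi_apply ℕ (fun _ => S) (fun _ => ⊤) i
  exact h (show @MeasurableSet S ⊤ A from trivial)

lemma meas_of_eval {Y : Type*} [MeasurableSpace Y] (i : ℕ) (r : S → Y) :
    Measurable (fun u : PathSpace S => r (u i)) := by
  intro B _
  exact meas_eval i (r ⁻¹' B)

lemma cyl_nil : cyl ([] : List S) = Set.univ := by
  ext u; simp [cyl]

lemma mem_cyl_cons (s : S) (l : List S) (u : PathSpace S) :
    u ∈ cyl (s :: l) ↔ u 0 = s ∧ (fun n => u (n+1)) ∈ cyl l := by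
  constructor
  · intro h
    refine ⟨h ⟨0, by simp⟩, fun i => ?_⟩
    exact h ⟨i.1+1, by simp⟩
  · rintro ⟨h0, h⟩ ⟨i, hi⟩
    cases i with
    | zero => exact h0
    | succ i => exact h ⟨i, by simpa using hi⟩

lemma meas_cyl (l : List S) : MeasurableSet (cyl l) := by
  have : cyl l = ⋂ i : Fin l.length, {u : PathSpace S | u i ∈ ({l.get i} : Set S)} := by
    ext u; simp [cyl]
  rw [this]
  exact MeasurableSet.iInter fun i => meas_eval _ _

/-- weight of a finite path -/
def wt : (List S → PMF S) → List S → ℝ≥0∞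
  | _, [] => 1
  | K, s :: l => K [] s * wt (fun h => K (s :: h)) l

lemma wt_snoc (K : List S → PMF S) (l : List S) (s : S) :
    wt K (l ++ [s]) = wt K l * K l s := by
  induction l generalizing K with
  | nil => simp [wt]
  | cons a l ih => simp [wt, ih, mul_assoc]

lemma wt_sum (n : ℕ) : ∀ K : List S → PMF S, ∑' l : Fin n → S, wt K (List.ofFn l) = 1 := by
  induction n with
  | zero => intro K; simp [wt]
  | succ n ih =>
    intro K
    rw [← (Fin.consEquiv (fun _ : Fin (n+1) => S)).tsum_eq]
    rw [ENNReal.tsum_prod']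
    have : ∀ (s : S) (l : Fin n → S),
        wt K (List.ofFn ((Fin.consEquiv (fun _ : Fin (n+1) => S)) (s, l)))
          = K [] s * wt (fun h => K (s :: h)) (List.ofFn l) := by
      intro s l
      have : List.ofFn ((Fin.consEquiv (fun _ : Fin (n+1) => S)) (s, l)) = s :: List.ofFn l := by
        simp [Fin.consEquiv, List.ofFn_succ]
      rw [this]; rfl
    simp only [this, ENNReal.tsum_mul_left, ih, mul_one]
    exact (K []).tsum_coe

lemma cyl_disj {n : ℕ} : Pairwise (Function.onFun Disjoint (fun l : Fin n → S => cyl (List.ofFn l))) := by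
  intro l l' hne
  rw [Function.onFun, Set.disjoint_left]
  intro u hu hu'
  apply hne
  funext i
  have h1 := hu ⟨i, by simp⟩
  have h2 := hu' ⟨i, by simp⟩
  simp at h1 h2
  rw [← h1, ← h2]

theorem exists_law (K : List S → PMF S) : ∃ μ : Measure (PathSpace S), IsProbabilityMeasure μ ∧
    ∀ l, μ (cyl l) = wt K l := by
  let : MeasurableSpace (List S) := ⊤
  let k : Kernel (List S) (List S) :=
    ⟨fun w => ((K w).map (fun s => w ++ [s])).toMeasure, measurable_from_top⟩
  have hk : ∀ w, k w = ((K w).map (fun s => w ++ [s])).toMeasure := fun w => rfl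
  have : IsMarkovKernel k := ⟨fun w => by rw [hk]; infer_instance⟩
  let κ : (n : ℕ) → Kernel ((i : Finset.Iic n) → List S) (List S) := fun n =>
    k.comap (fun x => x ⟨n, by simp⟩) (measurable_pi_apply _)
  have : ∀ n, IsMarkovKernel (κ n) := fun n => by dsimp [κ]; infer_instance
  let x₀ : (i : Finset.Iic 0) → List S := fun _ => []
  let ν : Measure (ℕ → List S) := Kernel.traj (X := fun _ => List S) κ 0 x₀
  have : IsProbabilityMeasure ν := by dsimp [ν]; infer_instance
  -- lower bound
  have key : ∀ (l : List S) (n : ℕ), n ≤ l.length →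
      ν {w | ∀ i ≤ n, w i = l.take i} = wt K (l.take n) := by
    intro l n
    induction n with
    | zero =>
      intro _
      have h0 := Kernel.traj_map_frestrictLe_apply (X := fun _ => List S) (κ := κ) 0 0 x₀
      have hs : {w : ℕ → List S | ∀ i ≤ 0, w i = l.take i}
          = (Preorder.frestrictLe (π := fun _ => List S) 0) ⁻¹' {x | x ⟨0, by simp⟩ = []} := by
        ext w; simp
      have hm : MeasurableSet {x : (i : Finset.Iic 0) → List S | x ⟨0, by simp⟩ = []} :=
        by
        have := measurable_pi_apply (X := fun _ : Finset.Iic 0 => List S) (⟨0, by simp⟩ : Finset.Iic 0)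
        exact this (t := {[]}) (MeasurableSet.singleton ([] : List S))
      rw [hs, ← Measure.map_apply (by fun_prop) hm, h0]
      simp [wt]
      rw [Kernel.id_apply, Measure.dirac_apply' _ hm]
      simp [x₀]
    | succ n ih =>
      intro hn
      have h1 := Kernel.partialTraj_compProd_eq_map_traj (X := fun _ => List S) (κ := κ) (Nat.zero_le n) (x₀ := x₀)
      have hA : MeasurableSet {x : (i : Finset.Iic n) → List S | ∀ i : Finset.Iic n, x i = l.take i} := by
        have : {x : (i : Finset.Iic n) → List S | ∀ i : Finset.Iic n, x i = l.take i} = ⋂ i : Finset.Iic n, {x | x i = l.take i} := by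
          ext; simp
        rw [this]
        exact MeasurableSet.iInter fun i => (measurable_pi_apply i) (MeasurableSet.singleton _)
      have hs : {w : ℕ → List S | ∀ i ≤ n+1, w i = l.take i}
          = (fun x => (Preorder.frestrictLe (π := fun _ => List S) n x, x (n + 1))) ⁻¹'
            ({x | ∀ i : Finset.Iic n, x i = l.take i} ×ˢ {l.take (n+1)}) := by
        ext w
        simp only [Set.mem_ofPred_eq, Set.mem_preimage, Set.mem_prod, Set.mem_singleton_iff]
        constructor
        · intro h
          exact ⟨fun i => h i ((Finset.mem_Iic.1 i.2).trans (Nat.le_succ n)), h _ le_rfl⟩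
        · rintro ⟨h, h'⟩ i hi
          rcases Nat.lt_or_ge n i with h2 | h2
          · have : i = n+1 := by omega
            subst this; exact h'
          · exact h ⟨i, by simpa using h2⟩
      have hs' : {w : ℕ → List S | ∀ i ≤ n, w i = l.take i}
          = (Preorder.frestrictLe (π := fun _ => List S) n) ⁻¹' {x | ∀ i : Finset.Iic n, x i = l.take i} := by
        ext w
        simp
      have ih' := ih (by omega)
      have hmm : Measurable (fun x : ℕ → List S => (Preorder.frestrictLe (π := fun _ => List S) n x, x (n + 1))) :=
        (Preorder.measurable_frestrictLe n).prodMk (measurable_pi_apply _)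
      rw [hs', ← Measure.map_apply (by fun_prop) hA, Kernel.traj_map_frestrictLe_apply] at ih'
      rw [hs, ← Measure.map_apply hmm (hA.prod (MeasurableSet.singleton _)), ← h1,
        Measure.compProd_apply_prod hA (MeasurableSet.singleton _)]
      have hl : l.take (n+1) = l.take n ++ [l[n]] := by simp
      have : ∀ x ∈ {x : (i : Finset.Iic n) → List S | ∀ i : Finset.Iic n, x i = l.take i},
          (κ n x) {l.take (n+1)} = K (l.take n) l[n] := by
        intro x hx
        have h3 : x ⟨n, by simp⟩ = l.take n := hx _
        have : κ n x = k (x ⟨n, by simp⟩) := rfl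
        rw [this, h3, hk, PMF.toMeasure_apply_singleton _ _ (MeasurableSet.singleton _), hl,
          PMF.map_apply]
        rw [tsum_eq_single l[n]]
        · rw [if_pos rfl]
        · intro a ha
          rw [if_neg]
          intro h
          have := List.append_cancel_left h
          simp at this
          exact ha this.symm
      rw [setLIntegral_congr_fun hA this, setLIntegral_const, ih', hl, wt_snoc, mul_comm]
  let φ : (ℕ → List S) → PathSpace S := fun w n => (w (n+1)).getLastD (K []).support_nonempty.some
  have hφ : Measurable φ := by
    refine @measurable_pi_lambda _ _ _ _ (fun _ => ⊤) _ fun n => ?_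
    intro B _
    exact (measurable_pi_apply (X := fun _ : ℕ => List S) (n+1)) (t := {w | w.getLastD (K []).support_nonempty.some ∈ B}) trivial
  have : IsProbabilityMeasure (ν.map φ) := Measure.isProbabilityMeasure_map hφ.aemeasurable
  have hle : ∀ l : List S, wt K l ≤ (ν.map φ) (cyl l) := by
    intro l
    rw [Measure.map_apply hφ (meas_cyl l)]
    have := key l l.length le_rfl
    rw [List.take_length] at this
    rw [← this]
    refine measure_mono ?_
    intro w hw i
    have h1 : w (i+1) = l.take (i+1) := hw (i+1) i.2
    change (w (i+1)).getLastD _ = _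
    have h4 : l.take (i+1) = l.take i ++ [l[(i:ℕ)]] := by simp
    rw [h1, h4, List.getLastD_eq_getLast?, List.getLast?_concat]
    rfl
  refine ⟨ν.map φ, inferInstance, ?_⟩
  intro l
  have hsum : ∑' m : Fin l.length → S, (ν.map φ) (cyl (List.ofFn m)) ≤ 1 := by
    refine (tsum_meas_le_meas_iUnion_of_disjoint _ (fun m => meas_cyl _) cyl_disj).trans ?_
    exact prob_le_one
  have h2 := wt_sum l.length K
  by_contra hne
  have hlt : wt K (List.ofFn l.get) < (ν.map φ) (cyl (List.ofFn l.get)) := by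
    rw [List.ofFn_get]
    exact lt_of_le_of_ne (hle l) (Ne.symm hne)
  have := ENNReal.tsum_lt_tsum (by rw [h2]; simp) (fun m : Fin l.length → S => hle (List.ofFn m)) hlt
  rw [h2] at this
  exact absurd hsum (not_le.2 this)

/-- uniqueness -/
theorem law_unique (K : List S → PMF S) (μ ν : Measure (PathSpace S)) [IsProbabilityMeasure μ]
    [IsProbabilityMeasure ν] (hμ : ∀ l, l ≠ [] → μ (cyl l) = wt K l)
    (hν : ∀ l, l ≠ [] → ν (cyl l) = wt K l) : μ = ν := by
  have hμ' : ∀ l, μ (cyl l) = wt K l := by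
    intro l
    by_cases h : l = []
    · subst h; simp [cyl_nil, wt]
    · exact hμ l h
  have hν' : ∀ l, ν (cyl l) = wt K l := by
    intro l
    by_cases h : l = []
    · subst h; simp [cyl_nil, wt]
    · exact hν l h
  have conc : ∀ (ξ : Measure (PathSpace S)) [IsProbabilityMeasure ξ], (∀ l, ξ (cyl l) = wt K l) →
      ∀ n (Q : Set (PathSpace S)), MeasurableSet Q →
        (∀ l : Fin n → S, cyl (List.ofFn l) ⊆ Q ∨ Disjoint (cyl (List.ofFn l)) Q) →
        ξ Q = ∑' l : Fin n → S, if cyl (List.ofFn l) ⊆ Q then wt K (List.ofFn l) else 0 := by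
    intro ξ _ hξ n Q hQm hQ
    have hc : (Function.support fun l : Fin n → S => wt K (List.ofFn l)).Countable :=
      Summable.countable_support_ennreal (by rw [wt_sum]; simp)
    set C := Function.support fun l : Fin n → S => wt K (List.ofFn l)
    have : Countable C := hc
    have hU : ξ (⋃ l : C, cyl (List.ofFn l.1)) = 1 := by
      rw [measure_iUnion (f := fun l : C => cyl (List.ofFn l.1)) (fun a b hab => cyl_disj (fun h => hab (Subtype.ext h)))
        (fun l => meas_cyl _)]
      simp only [hξ]
      rw [tsum_subtype C (fun l => wt K (List.ofFn l)), Set.indicator_support, wt_sum]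
    have hUm : MeasurableSet (⋃ l : C, cyl (List.ofFn l.1)) := MeasurableSet.iUnion fun l => meas_cyl _
    have h1 : ξ Q = ξ (Q ∩ ⋃ l : C, cyl (List.ofFn l.1)) := by
      refine (measure_inter_conull ?_).symm
      exact (prob_compl_eq_zero_iff hUm).2 hU
    rw [h1, Set.inter_iUnion, measure_iUnion (f := fun l : C => Q ∩ cyl (List.ofFn l.1))
      (fun a b hab => (cyl_disj (fun h => hab (Subtype.ext h))).mono Set.inter_subset_right Set.inter_subset_right)
        (fun l => hQm.inter (meas_cyl _))]
    have : ∀ l : C, ξ (Q ∩ cyl (List.ofFn l.1)) =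
        (fun l : Fin n → S => if cyl (List.ofFn l) ⊆ Q then wt K (List.ofFn l) else 0) l.1 := by
      intro l
      by_cases h : cyl (List.ofFn l.1) ⊆ Q
      · simp only [h, if_true]; rw [Set.inter_eq_right.2 h, hξ]
      · simp only [h, if_false]
        rw [Set.inter_comm, ((hQ l.1).resolve_left h).inter_eq]; simp
    simp only [this]
    rw [tsum_subtype C (fun l : Fin n → S => if cyl (List.ofFn l) ⊆ Q then wt K (List.ofFn l) else 0)]
    congr 1
    funext l
    by_cases h : l ∈ C
    · simp [h]
    · rw [Set.indicator_of_notMem h]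
      have : wt K (List.ofFn l) = 0 := by simpa [C] using h
      simp [this]
  let mt : ℕ → MeasurableSpace S := fun _ => ⊤
  refine ext_of_generate_finite (@squareCylinders ℕ (fun _ => S) fun _ => {s | MeasurableSet[⊤] s}) ?_ ?_ ?_ (by simp)
  · exact (@generateFrom_squareCylinders ℕ (fun _ => S) mt).symm
  · exact isPiSystem_squareCylinders (fun _ => @MeasurableSpace.isPiSystem_measurableSet S ⊤) (fun _ => trivial)
  · rintro Q ⟨s, t, ⟨ht, rfl⟩⟩
    let Q : Set (PathSpace S) := {u | ∀ i ∈ s, u i ∈ t i}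
    change μ Q = ν Q
    have hQm : MeasurableSet Q := by
      have : Q = ⋂ i ∈ s, {u : PathSpace S | u i ∈ t i} := by
        ext u; simp [Q]
      rw [this]
      exact Finset.measurableSet_biInter s fun i _ => meas_eval i (t i)
    have hd : ∀ l : Fin (s.sup id + 1) → S, cyl (List.ofFn l) ⊆ Q ∨ Disjoint (cyl (List.ofFn l)) Q := by
      intro l
      have hlt : ∀ i ∈ s, i < s.sup id + 1 := fun i hi => Nat.lt_succ_of_le (Finset.le_sup (f := id) hi)
      have hh : ∀ u ∈ cyl (List.ofFn l), ∀ i (hi : i ∈ s), u i = l ⟨i, hlt i hi⟩ := by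
        intro u hu i hi
        have h1 := hu ⟨i, by simpa using hlt i hi⟩
        rw [List.get_ofFn] at h1
        exact h1
      by_cases h : ∀ i (hi : i ∈ s), l ⟨i, hlt i hi⟩ ∈ t i
      · left
        intro u hu i hi
        rw [hh u hu i hi]; exact h i hi
      · right
        push Not at h
        obtain ⟨i, hi, hn⟩ := h
        rw [Set.disjoint_left]
        intro u hu hu'
        apply hn
        rw [← hh u hu i hi]; exact hu' i hi
    rw [conc μ hμ' _ _ hQm hd, conc ν hν' _ _ hQm hd]

/-- the law of the process with transition `K` -/
def law (K : List S → PMF S) : Measure (PathSpace S) := (exists_law K).choose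

instance (K : List S → PMF S) : IsProbabilityMeasure (law K) := (exists_law K).choose_spec.1

lemma law_cyl (K : List S → PMF S) (l : List S) : law K (cyl l) = wt K l :=
  (exists_law K).choose_spec.2 l

lemma meas_consP (s : S) : Measurable (consP s) := by
  refine @measurable_pi_lambda _ _ _ _ (fun _ => ⊤) _ fun n => ?_
  intro B _
  cases n with
  | zero => exact MeasurableSet.const (s ∈ B)
  | succ n => exact meas_eval n B

lemma consP_emb (s : S) : MeasurableEmbedding (consP s) := by
  refine MeasurableEmbedding.of_measurable_inverse (g := fun u => (fun n => u (n+1) : PathSpace S))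
    (meas_consP s) ?_ ?_ ?_
  · have : Set.range (consP s) = {u : PathSpace S | u 0 ∈ ({s} : Set S)} := by
      ext u
      constructor
      · rintro ⟨v, rfl⟩; simp
      · intro h
        refine ⟨fun n => u (n+1), ?_⟩
        funext n
        cases n with
        | zero => exact h.symm
        | succ n => rfl
    rw [this]; exact meas_eval 0 _
  · refine @measurable_pi_lambda _ _ _ _ (fun _ => ⊤) _ fun n => ?_
    intro B _
    exact meas_eval (n+1) B
  · intro u; rfl

theorem law_step (K : List S → PMF S) :
    law K = Measure.sum (fun s : (K []).support =>
      K [] s.1 • (law (fun h => K (s.1 :: h))).map (consP s.1)) := by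
  have : Countable (K []).support := (K []).support_countable
  set ξ := Measure.sum (fun s : (K []).support =>
      K [] s.1 • (law (fun h => K (s.1 :: h))).map (consP s.1)) with hξ
  have happ : ∀ A, MeasurableSet A → ξ A = ∑' s : S, K [] s * (law (fun h => K (s :: h))) (consP s ⁻¹' A) := by
    intro A hA
    rw [hξ, Measure.sum_apply _ hA]
    simp only [Measure.smul_apply, smul_eq_mul]
    have : ∀ s : (K []).support, K [] s.1 * ((law (fun h => K (s.1 :: h))).map (consP s.1)) A =
      (fun s => K [] s * (law (fun h => K (s :: h))) (consP s ⁻¹' A)) s.1 := by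
      intro s
      rw [Measure.map_apply (meas_consP _) hA]
    simp only [this]
    rw [tsum_subtype (K []).support (fun s => K [] s * (law (fun h => K (s :: h))) (consP s ⁻¹' A))]
    congr 1
    funext s
    by_cases h : s ∈ (K []).support
    · simp [h]
    · rw [Set.indicator_of_notMem h]
      rw [(K []).apply_eq_zero_iff s |>.2 h]; simp
  have : IsProbabilityMeasure ξ := ⟨by
    rw [happ _ MeasurableSet.univ]
    simp [(K []).tsum_coe]⟩
  refine law_unique K _ _ (fun l _ => law_cyl K l) (fun l hl => ?_)
  rw [happ _ (meas_cyl l)]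
  cases l with
  | nil => exact absurd rfl hl
  | cons a l =>
    rw [tsum_eq_single a]
    · have : consP a ⁻¹' cyl (a :: l) = cyl l := by
        ext u; simp only [Set.mem_preimage, mem_cyl_cons]; simp; exact Iff.rfl
      rw [this, law_cyl]; rfl
    · intro b hb
      have : consP b ⁻¹' cyl (a :: l) = ∅ := by
        ext u; simp only [Set.mem_preimage, mem_cyl_cons]; simp [hb]
      rw [this]; simp

theorem lintegral_law (K : List S → PMF S) (f : PathSpace S → ℝ≥0∞) :
    ∫⁻ u, f u ∂(law K) = ∑' s, K [] s * ∫⁻ u, f (consP s u) ∂(law (fun h => K (s :: h))) := by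
  conv_lhs => rw [law_step]
  rw [lintegral_sum_measure]
  have : ∀ s : (K []).support, ∫⁻ u, f u ∂(K [] s.1 • (law (fun h => K (s.1 :: h))).map (consP s.1)) =
      (fun s => K [] s * ∫⁻ u, f (consP s u) ∂(law (fun h => K (s :: h)))) s.1 := by
    intro s
    rw [lintegral_smul_measure, (consP_emb s.1).lintegral_map]; rfl
  simp only [this]
  rw [tsum_subtype (K []).support (fun s => K [] s * ∫⁻ u, f (consP s u) ∂(law (fun h => K (s :: h))))]
  congr 1
  funext s
  by_cases h : s ∈ (K []).support
  · simp [h]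
  · rw [Set.indicator_of_notMem h]
    rw [(K []).apply_eq_zero_iff s |>.2 h]; simp

theorem ae_law (K : List S → PMF S) (p : PathSpace S → Prop) :
    (∀ᵐ u ∂(law K), p u) ↔ ∀ s, K [] s ≠ 0 → ∀ᵐ u ∂(law (fun h => K (s :: h))), p (consP s u) := by
  have : Countable (K []).support := (K []).support_countable
  conv_lhs => rw [law_step]
  rw [Measure.ae_sum_iff]
  constructor
  · intro h s hs
    have := h ⟨s, by simpa using hs⟩
    rw [Measure.ae_ennreal_smul_measure_iff hs, (consP_emb s).ae_map_iff] at this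
    exact this
  · intro h s
    have hs : K [] s.1 ≠ 0 := (PMF.mem_support_iff _ _).1 s.2
    rw [Measure.ae_ennreal_smul_measure_iff hs, (consP_emb s.1).ae_map_iff]
    exact h s.1 hs

end PL

namespace PL
open MeasureTheory ProbabilityTheory
open scoped ENNReal
variable {S : Type} {A : Arena S}

structure Prof (A : Arena S) where
  next : List S → S → S
  valid : ∀ (h : List S) (s : S), A.owner s ≠ Player.nature → A.E s ≠ ∅ → next h s ∈ A.E s

def Prof.shift (N : Prof A) (s : S) : Prof A := ⟨fun h => N.next (s :: h), fun h => N.valid (s :: h)⟩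

def mkP (f : S → ℝ≥0∞) (h : HasSum f 1) : PMF S := ⟨f, h⟩

def natPMF (A : Arena S) (s : S) : PMF S :=
  if h : HasSum (fun t => ENNReal.ofReal (A.prob s t)) 1 then mkP _ h else PMF.pure s

def Tn (A : Arena S) (f : S → S) (s : S) : PMF S :=
  if A.E s = ∅ then PMF.pure s else if A.owner s = Player.nature then natPMF A s else PMF.pure (f s)

lemma natPMF_apply (hA : A.Wellformed) {s : S} (hs : A.owner s = Player.nature) (t : S) :
    natPMF A s t = ENNReal.ofReal (A.prob s t) := by
  obtain ⟨h0, h1, h2⟩ := hA s hs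
  have : HasSum (fun t => ENNReal.ofReal (A.prob s t)) 1 := by
    have h3 := ENNReal.ofReal_tsum_of_nonneg h0 h1.summable
    rw [h1.tsum_eq, ENNReal.ofReal_one] at h3
    rw [h3]
    exact ENNReal.summable.hasSum
  rw [natPMF, dif_pos this]
  rfl

def KK (N : Prof A) (s : S) : List S → PMF S
  | [] => Tn A (N.next []) s
  | t :: h => KK (N.shift s) t h

lemma KK_cons (N : Prof A) (s t : S) : (fun h => KK N s (t :: h)) = KK (N.shift s) t := rfl

def PM (N : Prof A) (s : S) : Measure (PathSpace S) := (law (KK N s)).map (consP s)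

instance (N : Prof A) (s : S) : IsProbabilityMeasure (PM N s) :=
  Measure.isProbabilityMeasure_map (meas_consP s).aemeasurable

def Ex (N : Prof A) (s : S) (f : PathSpace S → ℝ≥0∞) : ℝ≥0∞ := ∫⁻ u, f u ∂(PM N s)

lemma Ex_eq (N : Prof A) (s : S) (f : PathSpace S → ℝ≥0∞) :
    Ex N s f = ∫⁻ u, f (consP s u) ∂(law (KK N s)) := by
  rw [Ex, PM, (consP_emb s).lintegral_map]

lemma Ex_step (N : Prof A) (s : S) (f : PathSpace S → ℝ≥0∞) :
    Ex N s f = ∑' t, Tn A (N.next []) s t * Ex (N.shift s) t (fun u => f (consP s u)) := by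
  rw [Ex_eq, lintegral_law]
  simp only [KK_cons, Ex_eq]
  rfl

lemma ae_PM (N : Prof A) (s : S) (p : PathSpace S → Prop) :
    (∀ᵐ u ∂(PM N s), p u) ↔ ∀ᵐ u ∂(law (KK N s)), p (consP s u) := by
  rw [PM, (consP_emb s).ae_map_iff]

lemma ae_step (N : Prof A) (s : S) (p : PathSpace S → Prop) :
    (∀ᵐ u ∂(PM N s), p u) ↔ ∀ t, Tn A (N.next []) s t ≠ 0 → ∀ᵐ u ∂(PM (N.shift s) t), p (consP s u) := by
  rw [ae_PM, ae_law]
  simp only [KK_cons, ae_PM]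
  rfl

lemma Tn_supp (hA : A.Wellformed) (N : Prof A) (s t : S) (h : Tn A (N.next []) s t ≠ 0) :
    t ∈ A.E s ∨ (A.E s = ∅ ∧ t = s) := by
  rw [Tn] at h
  split_ifs at h with h1 h2
  · right; refine ⟨h1, ?_⟩
    by_contra hne
    exact h (by simp [PMF.pure_apply, hne])
  · left
    rw [natPMF_apply hA h2] at h
    rw [(hA s h2).2.2]
    intro h3
    rw [h3] at h; simp at h
  · left
    have : t = N.next [] s := by
      by_contra hne
      exact h (by simp [PMF.pure_apply, hne])
    rw [this]; exact N.valid _ _ h2 h1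

lemma ae_zero (N : Prof A) (s : S) : ∀ᵐ u ∂(PM N s), u 0 = s := by
  rw [ae_PM]; simp

lemma ae_path (hA : A.Wellformed) (N : Prof A) (s : S) :
    ∀ᵐ u ∂(PM N s), ∀ i, u (i+1) ∈ A.E (u i) ∨ A.E (u i) = ∅ := by
  rw [ae_all_iff]
  intro i
  induction i generalizing N s with
  | zero =>
    rw [ae_step]
    intro t ht
    filter_upwards [ae_zero (N.shift s) t] with u hu
    simp only [zero_add, consP_succ, consP_zero, hu]
    rcases Tn_supp hA N s t ht with h | h
    · exact Or.inl h
    · exact Or.inr h.1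
  | succ i ih =>
    rw [ae_step]
    intro t _
    exact ih _ _

lemma Ex_mono_ae {N : Prof A} {s : S} {f g : PathSpace S → ℝ≥0∞} (h : ∀ᵐ u ∂(PM N s), f u ≤ g u) :
    Ex N s f ≤ Ex N s g := lintegral_mono_ae h

lemma Ex_mono {N : Prof A} {s : S} {f g : PathSpace S → ℝ≥0∞} (h : ∀ u, f u ≤ g u) :
    Ex N s f ≤ Ex N s g := lintegral_mono h

lemma Ex_const (N : Prof A) (s : S) (c : ℝ≥0∞) : Ex N s (fun _ => c) = c := by
  simp [Ex]

/-! ## comparison with the frozen path measure -/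

def comb (σ1 : Strategy A Player.one) (σ2 : Strategy A Player.two) : Prof A where
  next h s := if A.owner s = Player.one then σ1.next h s else σ2.next h s
  valid h s hs hE := by
    by_cases h1 : A.owner s = Player.one
    · simp only [h1, if_true]; exact σ1.valid h s h1 hE
    · simp only [h1, if_false]
      refine σ2.valid h s ?_ hE
      cases h2 : A.owner s <;> simp_all

lemma KK_snoc (l : List S) : ∀ (N : Prof A) (y x : S), KK N y (l ++ [x]) = Tn A (N.next (y :: l)) x := by
  induction l with
  | nil => intro N y x; rfl
  | cons a l ih => intro N y x; exact ih (N.shift y) a x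

def K0 (N : Prof A) (s : S) : List S → PMF S
  | [] => PMF.pure s
  | y :: h => KK N y h

lemma K0_snoc (N : Prof A) (s x : S) (l : List S) : K0 N s (l ++ [x]) = Tn A (N.next l) x := by
  cases l with
  | nil => rfl
  | cons a l => exact KK_snoc l N a x

lemma PM_cyl (N : Prof A) (s : S) (l : List S) (hl : l ≠ []) : PM N s (cyl l) = wt (K0 N s) l := by
  rw [PM, Measure.map_apply (meas_consP s) (meas_cyl l)]
  cases l with
  | nil => exact absurd rfl hl
  | cons a l =>
    by_cases h : a = s
    · subst h
      have : consP a ⁻¹' cyl (a :: l) = cyl l := by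
        ext u; simp only [Set.mem_preimage, mem_cyl_cons]; simp; exact Iff.rfl
      rw [this, law_cyl]
      simp [wt, K0]
    · have : consP s ⁻¹' cyl (a :: l) = ∅ := by
        ext u; simp only [Set.mem_preimage, mem_cyl_cons]; simp [Ne.symm h]
      rw [this]
      simp [wt, K0, h]

lemma pathProb_snoc (l : List S) (s t : S) :
    pathProb A (l ++ [s, t]) = pathProb A (l ++ [s]) * stepProb A s t := by
  induction l with
  | nil => simp [pathProb]
  | cons a l ih =>
    cases l with
    | nil => simp [pathProb]
    | cons b l => simp only [List.cons_append, pathProb] at ih ⊢; rw [ih, mul_assoc]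

def Allowed (A : Arena S) (N : Prof A) (l : List S) (s t : S) : Prop :=
  (A.E s = ∅ ∧ t = s) ∨ (A.E s ≠ ∅ ∧ A.owner s = Player.nature ∧ t ∈ A.E s) ∨
    (A.E s ≠ ∅ ∧ A.owner s ≠ Player.nature ∧ t = N.next l s)

lemma MC_inv {σ1 : Strategy A Player.one} {σ2 : Strategy A Player.two} {s0 : S} {L : List S}
    (h : MC A σ1 σ2 s0 L) : L = [s0] ∨ ∃ l s t, L = l ++ [s, t] ∧ MC A σ1 σ2 s0 (l ++ [s]) ∧
      Allowed A (comb σ1 σ2) l s t := by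
  cases h with
  | root => exact Or.inl rfl
  | one l s h h1 h2 => exact Or.inr ⟨l, s, _, rfl, h, Or.inr (Or.inr ⟨h2, by simp [h1], by simp [comb, h1]⟩)⟩
  | two l s h h1 h2 => exact Or.inr ⟨l, s, _, rfl, h, Or.inr (Or.inr ⟨h2, by simp [h1], by simp [comb, h1]⟩)⟩
  | nature l s t h h1 h2 => exact Or.inr ⟨l, s, t, rfl, h, Or.inr (Or.inl ⟨Set.nonempty_iff_ne_empty.1 ⟨t, h2⟩, h1, h2⟩)⟩
  | term l s h h1 => exact Or.inr ⟨l, s, _, rfl, h, Or.inl ⟨h1, rfl⟩⟩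

lemma MC_snoc {σ1 : Strategy A Player.one} {σ2 : Strategy A Player.two} {s0 : S} (l : List S) (s t : S) :
    MC A σ1 σ2 s0 (l ++ [s, t]) ↔ MC A σ1 σ2 s0 (l ++ [s]) ∧ Allowed A (comb σ1 σ2) l s t := by
  constructor
  · intro h
    rcases MC_inv h with h | ⟨l', s', t', h, h1, h2⟩
    · have := congrArg List.length h; simp at this
    · have e : (l ++ [s]) ++ [t] = (l' ++ [s']) ++ [t'] := by simpa using h
      obtain ⟨e1, e2⟩ := List.append_inj' e rfl
      obtain ⟨e3, e4⟩ := List.append_inj' e1 rfl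
      simp at e2 e4
      subst e2; subst e4; subst e3
      exact ⟨h1, h2⟩
  · rintro ⟨h, h1 | ⟨h1, h2, h3⟩ | ⟨h1, h2, h3⟩⟩
    · rw [h1.2]; exact MC.term l s h h1.1
    · exact MC.nature l s t h h2 h3
    · rw [h3]
      cases h4 : A.owner s with
      | one => simp only [comb, h4, if_true]; exact MC.one l s h h4 h1
      | two => simp only [comb, h4]; exact MC.two l s h h4 h1
      | nature => exact absurd h4 h2

lemma pathProb_nonneg (hA : A.Wellformed) (l : List S) : 0 ≤ pathProb A l := by
  have hs : ∀ s t, 0 ≤ stepProb A s t := by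
    intro s t
    rw [stepProb]; split_ifs with h
    · exact (hA s h).1 t
    · exact zero_le_one
  induction l with
  | nil => simp [pathProb]
  | cons a l ih =>
    cases l with
    | nil => simp [pathProb]
    | cons b l => exact mul_nonneg (hs _ _) ih

lemma cylWeight_eq (hA : A.Wellformed) (σ1 : Strategy A Player.one) (σ2 : Strategy A Player.two) (s0 : S)
    (l : List S) (hl : l ≠ []) :
    ENNReal.ofReal (cylWeight A σ1 σ2 s0 l) = wt (K0 (comb σ1 σ2) s0) l := by
  induction l using List.reverseRecOn with
  | nil => exact absurd rfl hl
  | append_singleton l t ih =>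
    rcases List.eq_nil_or_concat l with rfl | ⟨l, s, rfl⟩
    · have : MC A σ1 σ2 s0 [t] ↔ t = s0 := by
        constructor
        · intro h
          rcases MC_inv h with h | ⟨l', s', t', h, h1, h2⟩
          · simpa using h
          · have := congrArg List.length h; simp at this
        · rintro rfl; exact MC.root
      simp only [List.nil_append, cylWeight, this, wt, K0, pathProb, PMF.pure_apply, mul_one]
      split_ifs <;> simp
    · rw [List.concat_eq_append] at ih ⊢
      have ih := ih (by simp)
      rw [wt_snoc, ← ih, K0_snoc]
      have e : l ++ [s] ++ [t] = l ++ [s, t] := by simp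
      rw [e, cylWeight, cylWeight, MC_snoc, pathProb_snoc]
      by_cases hm : MC A σ1 σ2 s0 (l ++ [s])
      · simp only [hm, true_and, if_true]
        rw [Tn]
        by_cases hE : A.E s = ∅
        · simp only [hE, Allowed, if_true, PMF.pure_apply]
          have : A.owner s ≠ Player.nature := by
            intro hn
            have h1 := (hA s hn).2.2
            rw [hE] at h1
            have h2 := (hA s hn).2.1
            rw [Function.support_eq_empty_iff.1 h1.symm] at h2
            have h3 := h2.unique hasSum_zero
            exact one_ne_zero h3
          simp only [stepProb, this]
          split_ifs <;> simp_all
        · simp only [hE, Allowed, if_false]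
          by_cases hn : A.owner s = Player.nature
          · simp only [hn, if_true, natPMF_apply hA hn, stepProb]
            by_cases ht : t ∈ A.E s
            · simp only [ht]
              simp [hE, ENNReal.ofReal_mul (pathProb_nonneg hA _)]
            · have : A.prob s t = 0 := by
                rw [(hA s hn).2.2] at ht
                simpa using ht
              simp [ht, this]
          · simp only [hn, stepProb, PMF.pure_apply]
            by_cases ht : t = (comb σ1 σ2).next l s
            · simp [ht, hE, hn]
            · simp [ht]
      · simp [hm]

theorem pathMeasure_eq (hA : A.Wellformed) (σ1 : Strategy A Player.one) (σ2 : Strategy A Player.two) (s0 : S) :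
    pathMeasure A σ1 σ2 s0 = PM (comb σ1 σ2) s0 := by
  have hex : ∃ μ : MeasureTheory.Measure (PathSpace S), MeasureTheory.IsProbabilityMeasure μ ∧
      ∀ l : List S, l ≠ [] → μ (cyl l) = ENNReal.ofReal (cylWeight A σ1 σ2 s0 l) :=
    ⟨PM (comb σ1 σ2) s0, inferInstance, fun l hl => by rw [PM_cyl _ _ _ hl, cylWeight_eq hA _ _ _ _ hl]⟩
  rw [pathMeasure, dif_pos hex]
  have h := hex.choose_spec
  have := h.1
  refine law_unique (K0 (comb σ1 σ2) s0) _ _ (fun l hl => ?_) (fun l hl => PM_cyl _ _ _ hl)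
  rw [h.2 l hl, cylWeight_eq hA _ _ _ _ hl]

end PL

namespace PL
open MeasureTheory ProbabilityTheory
open scoped ENNReal
variable {S : Type} {A : Arena S}

def pay (D : S → Prop) (r : S → ℝ≥0∞) (par : PathSpace S → ℝ≥0∞) (u : PathSpace S) : ℝ≥0∞ :=
  if h : ∃ i, D (u i) then r (u (Nat.find h)) else par u

lemma pay_done {D : S → Prop} {r : S → ℝ≥0∞} {par : PathSpace S → ℝ≥0∞} {s : S} (hs : D s) (u : PathSpace S) :
    pay D r par (consP s u) = r s := by
  have h : ∃ i, D (consP s u i) := ⟨0, hs⟩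
  rw [pay, dif_pos h]
  have : Nat.find h = 0 := (Nat.find_eq_zero h).2 hs
  rw [this]; rfl

lemma pay_step {D : S → Prop} {r : S → ℝ≥0∞} {par : PathSpace S → ℝ≥0∞}
    (hpar : ∀ s u, par (consP s u) = par u) {s : S} (hs : ¬ D s) (u : PathSpace S) :
    pay D r par (consP s u) = pay D r par u := by
  by_cases h : ∃ i, D (u i)
  · have h' : ∃ i, D (consP s u i) := by obtain ⟨i, hi⟩ := h; exact ⟨i+1, hi⟩
    rw [pay, pay, dif_pos h, dif_pos h']
    have : Nat.find h' = Nat.find h + 1 := by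
      rw [Nat.find_eq_iff]
      refine ⟨Nat.find_spec h, ?_⟩
      intro n hn
      cases n with
      | zero => exact hs
      | succ n => exact Nat.find_min h (by omega)
    rw [this]; rfl
  · have h' : ¬ ∃ i, D (consP s u i) := by
      rintro ⟨i, hi⟩
      cases i with
      | zero => exact hs hi
      | succ i => exact h ⟨i, hi⟩
    rw [pay, pay, dif_neg h, dif_neg h', hpar]

lemma meas_ev (D : S → Prop) (i : ℕ) : MeasurableSet {u : PathSpace S | D (u i)} := meas_eval i {s | D s}

lemma meas_first (D E : S → Prop) (i : ℕ) : MeasurableSet {u : PathSpace S | D (u i) ∧ ∀ j < i, ¬ E (u j)} := by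
  refine (meas_ev D i).inter ?_
  have : {u : PathSpace S | ∀ j < i, ¬ E (u j)} = ⋂ j ∈ Finset.range i, {u : PathSpace S | ¬ E (u j)} := by
    ext u; simp
  change MeasurableSet {u : PathSpace S | ∀ j < i, ¬ E (u j)}
  rw [this]
  exact Finset.measurableSet_biInter _ fun j _ => meas_ev (fun s => ¬ E s) j

lemma meas_pay (D : S → Prop) (r : S → ℝ≥0∞) {par : PathSpace S → ℝ≥0∞} (hp : Measurable par) :
    Measurable (pay D r par) := by
  have : pay D r par = fun u => (∑' i, if D (u i) ∧ ∀ j < i, ¬ D (u j) then r (u i) else 0) +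
      (if ∀ i, ¬ D (u i) then par u else 0) := by
    funext u
    by_cases h : ∃ i, D (u i)
    · rw [pay, dif_pos h, tsum_eq_single (Nat.find h), if_pos, if_neg, add_zero]
      · push Not; exact h
      · exact ⟨Nat.find_spec h, fun j hj => Nat.find_min h hj⟩
      · intro i hi
        rw [if_neg]
        rintro ⟨h1, h2⟩
        exact hi (((Nat.find_eq_iff h).2 ⟨h1, h2⟩).symm)
    · rw [pay, dif_neg h]
      push Not at h
      simp [h]
  rw [this]
  refine Measurable.add ?_ ?_
  · refine Measurable.tsum fun i => ?_
    exact Measurable.ite (meas_first D D i) (meas_of_eval i r) measurable_const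
  · refine Measurable.ite ?_ hp measurable_const
    have : {u : PathSpace S | ∀ i, ¬ D (u i)} = ⋂ i, {u : PathSpace S | ¬ D (u i)} := by
      ext u; simp
    rw [this]
    exact MeasurableSet.iInter fun i => meas_ev (fun s => ¬ D s) i

/-! ## strategies -/

def Conf (g : Player) (D : S → Prop) (s : S) (ς : Strategy A g) (N : Prof A) : Prop :=
  ∀ l x, l.headD x = s → (∀ y ∈ l, ¬ D y) → ¬ D x → A.owner x = g → A.E x ≠ ∅ → N.next l x = ς.next l x

def shiftS {g : Player} (ς : Strategy A g) (s : S) : Strategy A g :=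
  ⟨fun h => ς.next (s :: h), fun h => ς.valid (s :: h)⟩

lemma Conf.step {g : Player} {D : S → Prop} {s : S} {ς : Strategy A g} {N : Prof A} (h : Conf g D s ς N)
    (hs : ¬ D s) (t : S) : Conf g D t (shiftS ς s) (N.shift s) := by
  intro l x _ h1 h2 h3 h4
  refine h (s :: l) x rfl ?_ h2 h3 h4
  intro y hy
  rcases List.mem_cons.1 hy with rfl | hy
  · exact hs
  · exact h1 y hy

def W (A : Arena S) (g : Player) (D : S → Prop) (Φ : PathSpace S → ℝ≥0∞) (s : S) (v : ℝ≥0∞) : Prop :=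
  ∃ ς : Strategy A g, ∀ N, Conf g D s ς N → Ex N s Φ ≤ v

def defS (A : Arena S) (g : Player) : Strategy A g where
  next _ x := if h : (A.E x).Nonempty then h.some else x
  valid _ x _ h := by
    have h' : (A.E x).Nonempty := Set.nonempty_iff_ne_empty.2 h
    simp only [h', dif_pos]
    exact h'.some_mem

lemma W_mono {g : Player} {D : S → Prop} {Φ : PathSpace S → ℝ≥0∞} {s : S} {v w : ℝ≥0∞}
    (h : W A g D Φ s v) (hvw : v ≤ w) : W A g D Φ s w := by
  obtain ⟨ς, hσ⟩ := h
  exact ⟨ς, fun N hN => (hσ N hN).trans hvw⟩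

lemma W_top {g : Player} {D : S → Prop} {Φ : PathSpace S → ℝ≥0∞} {s : S} : W A g D Φ s ⊤ :=
  ⟨defS A g, fun _ _ => le_top⟩

lemma W_done {g : Player} {D : S → Prop} {r : S → ℝ≥0∞} {par : PathSpace S → ℝ≥0∞} {s : S} (hs : D s) :
    W A g D (pay D r par) s (r s) := by
  refine ⟨defS A g, fun N _ => ?_⟩
  rw [Ex_eq]
  simp [pay_done hs]

lemma W_gen {g : Player} {D : S → Prop} {Φ : PathSpace S → ℝ≥0∞}
    (hΦ : ∀ s u, ¬ D s → Φ (consP s u) = Φ u) {s c : S} (hs : ¬ D s) (hc : c ∈ A.E s) (v : S → ℝ≥0∞)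
    (hv : ∀ t, W A g D Φ t (v t)) (V : ℝ≥0∞)
    (hV : ∀ N : Prof A, (A.owner s = g → N.next [] s = c) → ∑' t, Tn A (N.next []) s t * v t ≤ V) :
    W A g D Φ s V := by
  choose τ hτ using hv
  let ς : Strategy A g := {
    next := fun l x => match l with
      | [] => if x = s then c else (defS A g).next [] x
      | _ :: l => (τ (l.headD x)).next l x
    valid := by
      intro l x h1 h2
      cases l with
      | nil =>
        by_cases h : x = s
        · simp only [h, if_true]; exact hc
        · simp only [h, if_false]; exact (defS A g).valid _ _ h1 h2
      | cons a l => exact (τ (l.headD x)).valid _ _ h1 h2 }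
  refine ⟨ς, fun N hN => ?_⟩
  have h0 : A.owner s = g → N.next [] s = c := by
    intro ho
    have := hN [] s rfl (by simp) hs ho (Set.nonempty_iff_ne_empty.1 ⟨c, hc⟩)
    rw [this]; simp [ς]
  refine le_trans ?_ (hV N h0)
  rw [Ex_step]
  refine ENNReal.tsum_le_tsum fun t => ?_
  gcongr
  simp only [hΦ s _ hs]
  refine hτ t _ ?_
  intro l x h1 h2 h3 h4 h5
  rw [hN.step hs t l x h1 h2 h3 h4 h5]
  simp only [shiftS, ς]
  rw [h1]

lemma Tn_pure {N : Prof A} {s : S} (h1 : A.E s ≠ ∅) (h2 : A.owner s ≠ Player.nature) :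
    Tn A (N.next []) s = PMF.pure (N.next [] s) := by
  rw [Tn, if_neg h1, if_neg h2]

lemma W_own {g : Player} {D : S → Prop} {Φ : PathSpace S → ℝ≥0∞}
    (hΦ : ∀ s u, ¬ D s → Φ (consP s u) = Φ u) {s c : S} (hs : ¬ D s) (hc : c ∈ A.E s)
    (hg : A.owner s = g) (hgn : g ≠ Player.nature) {v : ℝ≥0∞} (hv : W A g D Φ c v) : W A g D Φ s v := by
  refine W_gen hΦ hs hc (fun t => if t = c then v else ⊤) ?_ v ?_
  · intro t
    by_cases h : t = c
    · simp only [h, if_true]; exact hv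
    · simp only [h, if_false]; exact W_top
  · intro N hN
    rw [Tn_pure (Set.nonempty_iff_ne_empty.1 ⟨c, hc⟩) (by rw [hg]; exact hgn), hN hg, tsum_eq_single c]
    · simp
    · intro b hb
      simp [PMF.pure_apply, hb]

lemma W_opp {g : Player} {D : S → Prop} {Φ : PathSpace S → ℝ≥0∞}
    (hΦ : ∀ s u, ¬ D s → Φ (consP s u) = Φ u) {s : S} (hs : ¬ D s) (hE : A.E s ≠ ∅)
    (hg : A.owner s ≠ Player.nature) {v : ℝ≥0∞} (hv : ∀ t ∈ A.E s, W A g D Φ t v) : W A g D Φ s v := by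
  obtain ⟨c, hc⟩ := Set.nonempty_iff_ne_empty.2 hE
  refine W_gen hΦ hs hc (fun t => if t ∈ A.E s then v else ⊤) ?_ v ?_
  · intro t
    by_cases h : t ∈ A.E s
    · simp only [h, if_true]; exact hv t h
    · simp only [h, if_false]; exact W_top
  · intro N hN
    rw [Tn_pure hE hg, tsum_eq_single (N.next [] s)]
    · simp [N.valid [] s hg hE]
    · intro b hb
      simp [PMF.pure_apply, hb]

lemma W_nat (hA : A.Wellformed) {g : Player} {D : S → Prop} {Φ : PathSpace S → ℝ≥0∞}
    (hΦ : ∀ s u, ¬ D s → Φ (consP s u) = Φ u) {s : S} (hs : ¬ D s) (hE : A.E s ≠ ∅)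
    (hg : A.owner s = Player.nature) (hgn : g ≠ Player.nature) (v : S → ℝ≥0∞) (hv : ∀ t ∈ A.E s, W A g D Φ t (v t)) :
    W A g D Φ s (∑' t, ENNReal.ofReal (A.prob s t) * v t) := by
  obtain ⟨c, hc⟩ := Set.nonempty_iff_ne_empty.2 hE
  refine W_gen hΦ hs hc (fun t => if t ∈ A.E s then v t else ⊤) ?_ _ ?_
  · intro t
    by_cases h : t ∈ A.E s
    · simp only [h, if_true]; exact hv t h
    · simp only [h, if_false]; exact W_top
  · intro N _
    refine ENNReal.tsum_le_tsum fun t => ?_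
    rw [Tn, if_neg hE, if_pos hg, natPMF_apply hA hg]
    by_cases h : t ∈ A.E s
    · simp [h]
    · have : A.prob s t = 0 := by
        rw [(hA s hg).2.2] at h
        simpa using h
      simp [this]

/-! ## switch lemma -/

def tailP (u : PathSpace S) : PathSpace S := fun n => u (n+1)

lemma meas_tailP : Measurable (tailP : PathSpace S → PathSpace S) := by
  refine @measurable_pi_lambda _ _ _ _ (fun _ => ⊤) _ fun n => ?_
  intro B _
  exact meas_eval (n+1) B

lemma consP_tailP (u : PathSpace S) : consP (u 0) (tailP u) = u := by
  funext n
  cases n <;> rfl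

def Psi (C : S → Prop) (r : S → ℝ≥0∞) (Θ : PathSpace S → ℝ≥0∞) : ℕ → PathSpace S → ℝ≥0∞
  | 0, u => Θ u
  | n+1, u => if C (u 0) then r (u 0) else Psi C r Θ n (tailP u)

lemma meas_Psi {C : S → Prop} {r : S → ℝ≥0∞} {Θ : PathSpace S → ℝ≥0∞} (h : Measurable Θ) (n : ℕ) :
    Measurable (Psi C r Θ n) := by
  induction n with
  | zero => exact h
  | succ n ih => exact Measurable.ite (meas_ev C 0) (meas_of_eval 0 r) (ih.comp meas_tailP)

lemma Psi_le {C : S → Prop} {r : S → ℝ≥0∞} {Θ : PathSpace S → ℝ≥0∞} {c : ℝ≥0∞} (hr : ∀ s, r s ≤ c)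
    (h : ∀ u, Θ u ≤ c) (n : ℕ) : ∀ u, Psi C r Θ n u ≤ c := by
  induction n with
  | zero => exact h
  | succ n ih => intro u; rw [Psi]; split_ifs; exacts [hr _, ih _]

lemma Psi_hit {C : S → Prop} {r : S → ℝ≥0∞} {Θ par : PathSpace S → ℝ≥0∞}
    (hpar : ∀ s u, par (consP s u) = par u) (i : ℕ) : ∀ (u : PathSpace S), C (u i) → ∀ n, i < n →
    Psi C r Θ n u = pay C r par u := by
  induction i with
  | zero =>
    intro u hu n hn
    obtain ⟨n, rfl⟩ : ∃ m, n = m + 1 := ⟨n-1, by omega⟩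
    rw [Psi, if_pos hu, ← consP_tailP u, pay_done hu]; rfl
  | succ i ih =>
    intro u hu n hn
    obtain ⟨n, rfl⟩ : ∃ m, n = m + 1 := ⟨n-1, by omega⟩
    by_cases h0 : C (u 0)
    · rw [Psi, if_pos h0, ← consP_tailP u, pay_done h0]; rfl
    · rw [Psi, if_neg h0, ih (tailP u) hu n (by omega)]
      conv_rhs => rw [← consP_tailP u, pay_step hpar h0]

lemma Psi_nohit {C : S → Prop} {r : S → ℝ≥0∞} {Θ : PathSpace S → ℝ≥0∞}
    (h2 : ∀ s u, ¬ C s → Θ (consP s u) = Θ u) (n : ℕ) : ∀ (u : PathSpace S), (∀ i, ¬ C (u i)) →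
    Psi C r Θ n u = Θ u := by
  induction n with
  | zero => intro u _; rfl
  | succ n ih =>
    intro u hu
    rw [Psi, if_neg (hu 0), ih (tailP u) (fun i => hu (i+1))]
    conv_rhs => rw [← consP_tailP u, h2 _ _ (hu 0)]

theorem switch {C : S → Prop} {r : S → ℝ≥0∞} {Θ par : PathSpace S → ℝ≥0∞}
    (hpar : ∀ s u, par (consP s u) = par u) (hΘ : Measurable Θ) {c : ℝ≥0∞} (hc : c ≠ ⊤)
    (hr : ∀ s, r s ≤ c) (hΘc : ∀ u, Θ u ≤ c)
    (h2 : ∀ s u, ¬ C s → Θ (consP s u) = Θ u)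
    (h4 : ∀ u, (∀ i, ¬ C (u i)) → Θ u ≤ par u)
    (Q : Prof A → S → Prop) (hQ1 : ∀ N s, Q N s → ¬ C s → ∀ t, Q (N.shift s) t)
    (hQ2 : ∀ N s, Q N s → C s → Ex N s Θ ≤ r s) (N : Prof A) (s : S) (hN : Q N s) :
    Ex N s Θ ≤ Ex N s (pay C r par) := by
  have key : ∀ n N s, Q N s → Ex N s Θ ≤ Ex N s (Psi C r Θ n) := by
    intro n
    induction n with
    | zero => intro N s _; exact le_rfl
    | succ n ih =>
      intro N s hN
      by_cases hs : C s
      · refine (hQ2 N s hN hs).trans ?_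
        rw [Ex_eq]
        have : ∀ u, Psi C r Θ (n+1) (consP s u) = r s := by
          intro u; rw [Psi, if_pos (show C (consP s u 0) from hs)]; rfl
        simp [this]
      · rw [Ex_step, Ex_step N s (Psi C r Θ (n+1))]
        refine ENNReal.tsum_le_tsum fun t => ?_
        gcongr
        simp only [h2 s _ hs]
        have : ∀ u, Psi C r Θ (n+1) (consP s u) = Psi C r Θ n u := by
          intro u; rw [Psi, if_neg (show ¬ C (consP s u 0) from hs)]; rfl
        simp only [this]
        exact ih _ _ (hQ1 N s hN hs t)
  have hlim : Filter.Tendsto (fun n => Ex N s (Psi C r Θ n)) Filter.atTop (nhds (Ex N s (pay C r Θ))) := by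
    refine tendsto_lintegral_of_dominated_convergence (fun _ => c) (fun n => meas_Psi hΘ n)
      (fun n => Filter.Eventually.of_forall (Psi_le hr hΘc n)) (by simpa using hc) ?_
    refine Filter.Eventually.of_forall fun u => ?_
    by_cases h : ∃ i, C (u i)
    · obtain ⟨i, hi⟩ := h
      refine tendsto_const_nhds.congr' ?_
      filter_upwards [Filter.eventually_gt_atTop i] with n hn
      rw [Psi_hit (par := par) hpar i u hi n hn, pay, pay, dif_pos ⟨i, hi⟩, dif_pos ⟨i, hi⟩]
    · push Not at h
      simp only [Psi_nohit h2 _ u h]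
      rw [pay, dif_neg (by push Not; exact h)]
      exact tendsto_const_nhds
  have h5 : Ex N s Θ ≤ Ex N s (pay C r Θ) := ge_of_tendsto' hlim fun n => key n N s hN
  refine h5.trans (Ex_mono fun u => ?_)
  rw [pay, pay]
  split_ifs with h
  · exact le_rfl
  · push Not at h; exact h4 u h

lemma pay_add {C : S → Prop} {r : S → ℝ≥0∞} {par : PathSpace S → ℝ≥0∞} (ε : ℝ≥0∞) (u : PathSpace S) :
    pay C (fun s => r s + ε) par u ≤ pay C r par u + ε := by
  rw [pay, pay]
  split_ifs
  · exact le_rfl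
  · exact le_self_add

lemma Ex_pay_add {N : Prof A} {s : S} {C : S → Prop} {r : S → ℝ≥0∞} {par : PathSpace S → ℝ≥0∞} (ε : ℝ≥0∞) :
    Ex N s (pay C (fun s => r s + ε) par) ≤ Ex N s (pay C r par) + ε := by
  refine (Ex_mono (pay_add ε)).trans ?_
  rw [Ex, Ex, lintegral_add_right _ measurable_const]
  simp

/-! ## finite glue -/

def glN {g : Player} (B : S → Prop) (τ : S → Strategy A g) : Strategy A g → List S → S → S
  | ς, [], x => if B x then (τ x).next [] x else ς.next [] x
  | ς, y :: l, x => if B y then (τ y).next (y :: l) x else glN B τ (shiftS ς y) l x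

lemma glN_valid {g : Player} (B : S → Prop) (τ : S → Strategy A g) (l : List S) : ∀ (ς : Strategy A g) (x : S),
    A.owner x = g → A.E x ≠ ∅ → glN B τ ς l x ∈ A.E x := by
  induction l with
  | nil =>
    intro ς x h1 h2; rw [glN]; split_ifs
    · exact (τ x).valid _ _ h1 h2
    · exact ς.valid _ _ h1 h2
  | cons y l ih =>
    intro ς x h1 h2; rw [glN]; split_ifs
    · exact (τ y).valid _ _ h1 h2
    · exact ih _ x h1 h2

def gl {g : Player} (B : S → Prop) (τ : S → Strategy A g) (ς : Strategy A g) : Strategy A g :=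
  ⟨glN B τ ς, fun l x => glN_valid B τ l ς x⟩

lemma gl_eq {g : Player} (B : S → Prop) (τ : S → Strategy A g) (l : List S) : ∀ (ς : Strategy A g) (x : S),
    (∀ y ∈ l, ¬ B y) → ¬ B x → (gl B τ ς).next l x = ς.next l x := by
  induction l with
  | nil => intro ς x _ h; simp [gl, glN, h]
  | cons y l ih =>
    intro ς x h1 h2
    have h3 := h1 y (by simp)
    have := ih (shiftS ς y) x (fun z hz => h1 z (by simp [hz])) h2
    simp only [gl, glN, h3, if_false] at this ⊢
    exact this

theorem W_glue {g : Player} {D B : S → Prop} {r r' : S → ℝ≥0∞} {par : PathSpace S → ℝ≥0∞}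
    (hpar : ∀ s u, par (consP s u) = par u) (hm : Measurable par) {c ε : ℝ≥0∞} (hc : c ≠ ⊤) (hε : ε ≠ ⊤)
    (hr : ∀ s, r s ≤ c) (hr' : ∀ s, r' s ≤ c) (hpc : ∀ u, par u ≤ c)
    (hDr : ∀ s, D s → r s ≤ r' s)
    (hB : ∀ b, B b → W A g D (pay D r par) b (r' b + ε)) {s : S} {v : ℝ≥0∞}
    (hW : W A g (fun s => D s ∨ B s) (pay (fun s => D s ∨ B s) r' par) s v) :
    W A g D (pay D r par) s (v + ε) := by
  obtain ⟨ς, hσ⟩ := hW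
  have hB' : ∀ b, ∃ τ : Strategy A g, B b → ∀ N, Conf g D b τ N → Ex N b (pay D r par) ≤ r' b + ε := by
    intro b
    by_cases h : B b
    · obtain ⟨τ, hτ⟩ := hB b h; exact ⟨τ, fun _ => hτ⟩
    · exact ⟨defS A g, fun h' => absurd h' h⟩
  choose τ hτ using hB'
  refine ⟨gl B τ ς, fun N hN => ?_⟩
  have h1 : Ex N s (pay D r par) ≤ Ex N s (pay (fun s => D s ∨ B s) (fun s => r' s + ε) par) := by
    refine switch (A := A) hpar (meas_pay D r hm) (c := c + ε) (by simp [hc, hε])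
      (fun s => by gcongr; exact hr' s) (fun u => ?_) (fun s u hs => ?_) (fun u hu => ?_)
      (fun N s => ∃ ς, Conf g D s (gl B τ ς) N) ?_ ?_ N s ⟨ς, hN⟩
    · refine le_trans ?_ (le_self_add : c ≤ c + ε)
      rw [pay]; split_ifs
      · exact hr _
      · exact hpc _
    · push Not at hs; exact pay_step hpar hs.1 u
    · push Not at hu
      rw [pay, dif_neg]
      push Not; exact fun i => (hu i).1
    · rintro N s ⟨ς, hσ⟩ hs t
      push Not at hs
      refine ⟨shiftS ς s, ?_⟩
      have : gl B τ (shiftS ς s) = shiftS (gl B τ ς) s := by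
        simp only [gl, shiftS, glN, hs.2, if_false]
      rw [this]
      exact hσ.step hs.1 t
    · rintro N s ⟨ς, hσ⟩ hs
      by_cases hB : B s
      · refine hτ s hB N ?_
        intro l x h1 h2 h3 h4 h5
        rw [hσ l x h1 h2 h3 h4 h5]
        cases l with
        | nil =>
          have h1 : x = s := h1
          subst h1; simp [gl, glN, hB]
        | cons y l =>
          have h1 : y = s := h1
          subst h1; simp [gl, glN, hB]
      · have hD : D s := hs.resolve_right hB
        rw [Ex_eq]
        simp only [pay_done hD]
        simp
        exact (hDr s hD).trans le_self_add
  refine h1.trans ((Ex_pay_add ε).trans ?_)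
  gcongr
  refine hσ N ?_
  intro l x h1 h2 h3 h4 h5
  push Not at h3
  rw [hN l x h1 (fun y hy => (by have := h2 y hy; push Not at this; exact this.1)) h3.1 h4 h5]
  exact gl_eq B τ l ς x (fun y hy => (by have := h2 y hy; push Not at this; exact this.2)) h3.2

end PL

namespace PL
open MeasureTheory ProbabilityTheory
open scoped ENNReal
variable {S : Type} {A : Arena S}

def autoN {g : Player} (B : S → Prop) (τ : ℕ → S → Strategy A g) : ℕ → Strategy A g → List S → S → S
  | _, ς, [], x => ς.next [] x
  | k, ς, y :: l, x => if B y then autoN B τ (k+1) (τ k y) l x else autoN B τ k (shiftS ς y) l x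

lemma autoN_valid {g : Player} (B : S → Prop) (τ : ℕ → S → Strategy A g) (l : List S) :
    ∀ (k : ℕ) (ς : Strategy A g) (x : S), A.owner x = g → A.E x ≠ ∅ → autoN B τ k ς l x ∈ A.E x := by
  induction l with
  | nil => intro k ς x h1 h2; exact ς.valid _ _ h1 h2
  | cons y l ih =>
    intro k ς x h1 h2; rw [autoN]; split_ifs
    · exact ih _ _ x h1 h2
    · exact ih _ _ x h1 h2

def autoS {g : Player} (B : S → Prop) (τ : ℕ → S → Strategy A g) (k : ℕ) (ς : Strategy A g) : Strategy A g :=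
  ⟨autoN B τ k ς, fun l x => autoN_valid B τ l k ς x⟩

lemma auto_eq {g : Player} (B : S → Prop) (τ : ℕ → S → Strategy A g) (k : ℕ) (l : List S) :
    ∀ (ς : Strategy A g) (x : S), (∀ y ∈ l, ¬ B y) → (autoS B τ k ς).next l x = ς.next l x := by
  induction l with
  | nil => intro ς x _; rfl
  | cons y l ih =>
    intro ς x h1
    have h3 := h1 y (by simp)
    have := ih (shiftS ς y) x (fun z hz => h1 z (by simp [hz]))
    simp only [autoS, autoN, h3, if_false] at this ⊢
    exact this

lemma auto_shift {g : Player} {B : S → Prop} {τ : ℕ → S → Strategy A g} {k : ℕ} {ς : Strategy A g} {s : S}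
    (hs : ¬ B s) : shiftS (autoS B τ k ς) s = autoS B τ k (shiftS ς s) := by
  simp only [autoS, shiftS, autoN, hs, if_false]

lemma auto_shift' {g : Player} {B : S → Prop} {τ : ℕ → S → Strategy A g} {k : ℕ} {ς : Strategy A g} {s : S}
    (hs : B s) : shiftS (autoS B τ k ς) s = autoS B τ (k+1) (τ k s) := by
  simp only [autoS, shiftS, autoN, hs, if_true]

def cnt (D B : S → Prop) (u : PathSpace S) : ℝ≥0∞ :=
  ∑' i, if B (u i) ∧ ∀ j < i, ¬ D (u j) then 1 else 0

lemma meas_cnt (D B : S → Prop) : Measurable (cnt D B) := by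
  refine Measurable.tsum fun i => ?_
  exact Measurable.ite (meas_first B D i) measurable_const measurable_const

lemma cnt_step {D B : S → Prop} {s : S} (hs : ¬ D s) (u : PathSpace S) :
    cnt D B (consP s u) = (if B s then 1 else 0) + cnt D B u := by
  rw [cnt, tsum_eq_zero_add' ENNReal.summable]
  congr 1
  · simp
  · rw [cnt]
    congr 1
    funext i
    have : (∀ j < i+1, ¬ D (consP s u j)) ↔ ∀ j < i, ¬ D (u j) := by
      constructor
      · intro h j hj; exact h (j+1) (by omega)
      · intro h j hj
        cases j with
        | zero => exact hs
        | succ j => exact h j (by omega)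
    simp only [consP_succ, this]

lemma cnt_top {D B : S → Prop} {u : PathSpace S} (h : cnt D B u = ⊤) :
    (∀ i, ¬ D (u i)) ∧ {i | B (u i)}.Infinite := by
  have hfin : ∀ n, (∀ i ≥ n, ¬ (B (u i) ∧ ∀ j < i, ¬ D (u j))) → False := by
    intro n hn
    have : cnt D B u = ∑ i ∈ Finset.range n, if B (u i) ∧ ∀ j < i, ¬ D (u j) then 1 else 0 := by
      rw [cnt]
      refine tsum_eq_sum ?_
      intro i hi
      rw [if_neg (hn i (by simpa using hi))]
    rw [h] at this
    have h2 : (∑ i ∈ Finset.range n, if B (u i) ∧ ∀ j < i, ¬ D (u j) then (1:ℝ≥0∞) else 0) < ⊤ := by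
      refine ENNReal.sum_lt_top.2 fun i _ => ?_
      split_ifs <;> simp
    exact absurd this.symm h2.ne
  constructor
  · intro i hi
    exact hfin (i+1) fun k hk hk2 => hk2.2 i (by omega) hi
  · rw [Set.infinite_iff_exists_gt]
    intro a
    by_contra hcon
    push Not at hcon
    exact hfin (a+1) fun k hk hk2 => absurd (hcon k hk2.1) (by omega)

def Theta (D B : S → Prop) (Φ : PathSpace S → ℝ≥0∞) (n : ℕ) (u : PathSpace S) : ℝ≥0∞ :=
  if cnt D B u < n then Φ u else 0

lemma Theta_le {D B : S → Prop} {Φ : PathSpace S → ℝ≥0∞} {n : ℕ} (u : PathSpace S) :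
    Theta D B Φ n u ≤ Φ u := by
  rw [Theta]; split_ifs <;> simp

lemma meas_Theta {D B : S → Prop} {Φ : PathSpace S → ℝ≥0∞} (h : Measurable Φ) (n : ℕ) :
    Measurable (Theta D B Φ n) :=
  Measurable.ite (measurableSet_lt (meas_cnt D B) measurable_const) h measurable_const

lemma half_add (ε : ℝ≥0∞) (k : ℕ) : ε * 2⁻¹ ^ (k+1) + ε * 2⁻¹ ^ (k+1) = ε * 2⁻¹ ^ k := by
  rw [← mul_add, pow_succ, ← mul_add, ENNReal.inv_two_add_inv_two, mul_one]

theorem W_inf {g : Player} {D B : S → Prop} {r r' : S → ℝ≥0∞} {par : PathSpace S → ℝ≥0∞}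
    (hpar : ∀ s u, par (consP s u) = par u) (hm : Measurable par) {c ε : ℝ≥0∞} (hc : c ≠ ⊤) (hε : ε ≠ ⊤)
    (hε0 : ε ≠ 0) (hr : ∀ s, r s ≤ c) (hr' : ∀ s, r' s ≤ c) (hpc : ∀ u, par u ≤ c)
    (hDr : ∀ s, D s → r s ≤ r' s) (nx : S → S)
    (hBD : ∀ b, B b → ¬ D b) (hBE : ∀ b, B b → A.E b = {nx b}) (hBo : ∀ b, B b → A.owner b ≠ Player.nature)
    (hB : ∀ b, B b → ∀ δ, δ ≠ 0 → δ ≠ ⊤ → W A g (fun s => D s ∨ B s) (pay (fun s => D s ∨ B s) r' par) (nx b) (r' b + δ))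
    {s : S} {v : ℝ≥0∞}
    (hpi : ∀ N : Prof A, ∀ᵐ u ∂(PM N s), (∀ i, ¬ D (u i)) → {i | B (u i)}.Infinite → par u = 0)
    (hW : W A g (fun s => D s ∨ B s) (pay (fun s => D s ∨ B s) r' par) s v) :
    W A g D (pay D r par) s (v + ε) := by
  have hδ0 : ∀ k : ℕ, ε * 2⁻¹ ^ k ≠ 0 := fun k => by simp [hε0]
  have hδt : ∀ k : ℕ, ε * 2⁻¹ ^ k ≠ ⊤ := fun k => ENNReal.mul_ne_top hε (by simp)
  obtain ⟨ς, hς⟩ := hW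
  have hB' : ∀ (k : ℕ) b, ∃ τ : Strategy A g, B b → ∀ N, Conf g (fun s => D s ∨ B s) (nx b) τ N →
      Ex N (nx b) (pay (fun s => D s ∨ B s) r' par) ≤ r' b + ε * 2⁻¹ ^ (k+1) := by
    intro k b
    by_cases h : B b
    · obtain ⟨τ, hτ⟩ := hB b h (ε * 2⁻¹ ^ (k+1)) (hδ0 _) (hδt _); exact ⟨τ, fun _ => hτ⟩
    · exact ⟨defS A g, fun h' => absurd h' h⟩
  choose τ hτ using hB'
  have hconf : ∀ (k : ℕ) (ς : Strategy A g) N s, Conf g D s (autoS B τ k ς) N →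
      Conf g (fun s => D s ∨ B s) s ς N := by
    intro k ς N s hN l x h1 h2 h3 h4 h5
    push Not at h3
    rw [hN l x h1 (fun y hy => (by have := h2 y hy; push Not at this; exact this.1)) h3.1 h4 h5]
    exact auto_eq B τ k l ς x (fun y hy => (by have := h2 y hy; push Not at this; exact this.2))
  have hΦc : ∀ u, pay D r par u ≤ c := by
    intro u
    rw [pay]; split_ifs
    · exact hr _
    · exact hpc _
  have key : ∀ n (k : ℕ) (ς : Strategy A g) N s v, Conf g D s (autoS B τ k ς) N →
      (∀ N', Conf g (fun s => D s ∨ B s) s ς N' → Ex N' s (pay (fun s => D s ∨ B s) r' par) ≤ v) →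
      Ex N s (Theta D B (pay D r par) n) ≤ v + ε * 2⁻¹ ^ k := by
    intro n
    induction n with
    | zero =>
      intro k ς N s v _ _
      have : Theta D B (pay D r par) 0 = fun _ => 0 := by funext u; simp [Theta]
      rw [this, Ex_const]; simp
    | succ n ih =>
      intro k ς N s v hN hv
      have h1 : Ex N s (Theta D B (pay D r par) (n+1)) ≤
          Ex N s (pay (fun s => D s ∨ B s) (fun s => r' s + ε * 2⁻¹ ^ k) par) := by
        refine switch (A := A) hpar (meas_Theta (meas_pay D r hm) _) (c := c + ε * 2⁻¹ ^ k)
          (ENNReal.add_ne_top.2 ⟨hc, hδt k⟩)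
          (fun s => by gcongr; exact hr' s) (fun u => ?_) (fun s u hs => ?_) (fun u hu => ?_)
          (fun N s => ∃ ς, Conf g D s (autoS B τ k ς) N) ?_ ?_ N s ⟨ς, hN⟩
        · exact (Theta_le u).trans ((hΦc u).trans le_self_add)
        · push Not at hs
          rw [Theta, Theta, pay_step hpar hs.1, cnt_step hs.1]
          simp [hs.2]
        · push Not at hu
          refine (Theta_le u).trans ?_
          rw [pay, dif_neg]
          push Not; exact fun i => (hu i).1
        · rintro N s ⟨ς, hς⟩ hs t
          push Not at hs
          refine ⟨shiftS ς s, ?_⟩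
          rw [← auto_shift hs.2]
          exact hς.step hs.1 t
        · rintro N s ⟨ς, hς⟩ hs
          by_cases hBs : B s
          · have hE : A.E s ≠ ∅ := by rw [hBE s hBs]; simp
            have hnx : N.next [] s = nx s := by
              have := N.valid [] s (hBo s hBs) hE
              rw [hBE s hBs] at this
              exact this
            rw [Ex_step, Tn_pure hE (hBo s hBs), hnx, tsum_eq_single (nx s)]
            · simp only [PMF.pure_apply, if_true, one_mul]
              have h2 := hς.step (hBD s hBs) (nx s)
              rw [auto_shift' hBs] at h2
              have h3 := ih (k+1) _ _ _ _ h2 (hτ k s hBs)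
              rw [add_assoc, half_add] at h3
              refine le_trans (le_of_eq ?_) h3
              congr 1
              funext u
              rw [Theta, Theta, pay_step hpar (hBD s hBs), cnt_step (hBD s hBs)]
              have : (if B s then (1:ℝ≥0∞) else 0) + cnt D B u < ((n+1 : ℕ) : ℝ≥0∞) ↔ cnt D B u < n := by
                rw [if_pos hBs, Nat.cast_add, Nat.cast_one, add_comm]
                exact ENNReal.add_lt_add_iff_right (by simp)
              simp only [this]
            · intro b hb
              simp [PMF.pure_apply, hb]
          · have hD : D s := hs.resolve_right hBs
            refine (Ex_mono Theta_le).trans ?_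
            rw [Ex_eq]
            simp only [pay_done hD]
            simp
            exact (hDr s hD).trans le_self_add
      refine h1.trans ((Ex_pay_add _).trans ?_)
      gcongr
      exact hv N (hconf k ς N s hN)
  refine ⟨autoS B τ 0 ς, fun N hN => ?_⟩
  have hk : ∀ n, Ex N s (Theta D B (pay D r par) n) ≤ v + ε := by
    intro n
    have := key n 0 ς N s v hN hς
    simpa using this
  have h1 : Ex N s (pay D r par) ≤ Ex N s (fun u => ⨆ n, Theta D B (pay D r par) n u) := by
    refine Ex_mono_ae ?_
    filter_upwards [hpi N] with u hu
    by_cases h : cnt D B u = ⊤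
    · obtain ⟨h1, h2⟩ := cnt_top h
      rw [pay, dif_neg (by push Not; exact h1), hu h1 h2]
      exact bot_le
    · obtain ⟨n, hn⟩ := ENNReal.exists_nat_gt h
      refine le_iSup_of_le n ?_
      rw [Theta, if_pos hn]
  refine h1.trans ?_
  rw [Ex, lintegral_iSup (fun n => meas_Theta (meas_pay D r hm) n)]
  · exact iSup_le hk
  · intro n m hnm u
    simp only [Theta]
    by_cases h : cnt D B u < n
    · rw [if_pos h, if_pos (h.trans_le (by exact_mod_cast hnm))]
    · rw [if_neg h]; exact bot_le

end PL

namespace PL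
open MeasureTheory ProbabilityTheory
open scoped ENNReal
variable {L P : Type}

/-! ## syntax -/

lemma bodyOf_none {G : pLmu L} {X : ℕ} : pLmu.bodyOf G X = none ↔ X ∉ G.binders := by
  induction G with
  | var Y => simp [pLmu.bodyOf, pLmu.binders]
  | dia a G ih => simpa [pLmu.bodyOf, pLmu.binders] using ih
  | box a G ih => simpa [pLmu.bodyOf, pLmu.binders] using ih
  | or G H ih1 ih2 => simp [pLmu.bodyOf, pLmu.binders, ih1, ih2]
  | and G H ih1 ih2 => simp [pLmu.bodyOf, pLmu.binders, ih1, ih2]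
  | mu Y G ih =>
    by_cases h : Y = X
    · simp [pLmu.bodyOf, pLmu.binders, h]
    · simp [pLmu.bodyOf, pLmu.binders, h, ih, Ne.symm h]
  | nu Y G ih =>
    by_cases h : Y = X
    · simp [pLmu.bodyOf, pLmu.binders, h]
    · simp [pLmu.bodyOf, pLmu.binders, h, ih, Ne.symm h]

lemma varInfo_none {G : pLmu L} {X : ℕ} : ∀ d, pLmu.varInfo G d X = none ↔ X ∉ G.binders := by
  induction G with
  | var Y => simp [pLmu.varInfo, pLmu.binders]
  | dia a G ih => intro d; simpa [pLmu.varInfo, pLmu.binders] using ih _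
  | box a G ih => intro d; simpa [pLmu.varInfo, pLmu.binders] using ih _
  | or G H ih1 ih2 => intro d; simp [pLmu.varInfo, pLmu.binders, ih1, ih2]
  | and G H ih1 ih2 => intro d; simp [pLmu.varInfo, pLmu.binders, ih1, ih2]
  | mu Y G ih =>
    intro d
    by_cases h : Y = X
    · simp [pLmu.varInfo, pLmu.binders, h]
    · simp [pLmu.varInfo, pLmu.binders, h, ih, Ne.symm h]
  | nu Y G ih =>
    intro d
    by_cases h : Y = X
    · simp [pLmu.varInfo, pLmu.binders, h]
    · simp [pLmu.varInfo, pLmu.binders, h, ih, Ne.symm h]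

lemma varInfo_ge {G : pLmu L} {X : ℕ} : ∀ d e, pLmu.varInfo G d X = some e → d ≤ e.1 := by
  induction G with
  | var Y => simp [pLmu.varInfo]
  | dia a G ih => intro d e h; have := ih (d+1) e h; omega
  | box a G ih => intro d e h; have := ih (d+1) e h; omega
  | or G H ih1 ih2 =>
    intro d e h
    simp only [pLmu.varInfo] at h
    cases h1 : pLmu.varInfo G (d+1) X with
    | none => rw [h1] at h; have := ih2 (d+1) e h; omega
    | some e' => rw [h1] at h; have := ih1 (d+1) e (h1.trans h); omega
  | and G H ih1 ih2 =>
    intro d e h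
    simp only [pLmu.varInfo] at h
    cases h1 : pLmu.varInfo G (d+1) X with
    | none => rw [h1] at h; have := ih2 (d+1) e h; omega
    | some e' => rw [h1] at h; have := ih1 (d+1) e (h1.trans h); omega
  | mu Y G ih =>
    intro d e h
    simp only [pLmu.varInfo] at h
    split_ifs at h
    · simp at h; simp [← h]
    · have := ih (d+1) e h; omega
  | nu Y G ih =>
    intro d e h
    simp only [pLmu.varInfo] at h
    split_ifs at h
    · simp at h; simp [← h]
    · have := ih (d+1) e h; omega

def sub : pLmu L → Set (pLmu L)
  | .var X => {.var X}
  | .dia a G => insert (.dia a G) (sub G)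
  | .box a G => insert (.box a G) (sub G)
  | .or G H => insert (.or G H) (sub G ∪ sub H)
  | .and G H => insert (.and G H) (sub G ∪ sub H)
  | .mu X G => insert (.mu X G) (sub G)
  | .nu X G => insert (.nu X G) (sub G)

lemma sub_self (G : pLmu L) : G ∈ sub G := by
  cases G <;> simp [sub]

lemma sub_trans {G H : pLmu L} (h : G ∈ sub H) : sub G ⊆ sub H := by
  induction H with
  | var X => simp [sub] at h; rw [h]
  | dia a K ih =>
    rcases h with h | h
    · rw [h]
    · exact (ih h).trans (Set.subset_insert _ _)
  | box a K ih =>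
    rcases h with h | h
    · rw [h]
    · exact (ih h).trans (Set.subset_insert _ _)
  | or K K' ih ih' =>
    rcases h with h | h | h
    · rw [h]
    · exact (ih h).trans (Set.subset_union_left.trans (Set.subset_insert _ _))
    · exact (ih' h).trans (Set.subset_union_right.trans (Set.subset_insert _ _))
  | and K K' ih ih' =>
    rcases h with h | h | h
    · rw [h]
    · exact (ih h).trans (Set.subset_union_left.trans (Set.subset_insert _ _))
    · exact (ih' h).trans (Set.subset_union_right.trans (Set.subset_insert _ _))
  | mu X K ih =>
    rcases h with h | h
    · rw [h]
    · exact (ih h).trans (Set.subset_insert _ _)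
  | nu X K ih =>
    rcases h with h | h
    · rw [h]
    · exact (ih h).trans (Set.subset_insert _ _)

lemma sub_var {H : pLmu L} {Y : ℕ} (h : pLmu.var Y ∈ sub H) : Y ∈ H.freeVars ∨ Y ∈ H.binders := by
  induction H with
  | var X => simp [sub] at h; simp [pLmu.freeVars, h]
  | dia a K ih => exact ih (by simpa [sub] using h)
  | box a K ih => exact ih (by simpa [sub] using h)
  | or K K' ih ih' =>
    have h : pLmu.var Y ∈ sub K ∨ pLmu.var Y ∈ sub K' := by simpa [sub] using h
    simp only [pLmu.freeVars, pLmu.binders, Set.mem_union, List.mem_append]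
    rcases h with h | h
    · have := ih h; tauto
    · have := ih' h; tauto
  | and K K' ih ih' =>
    have h : pLmu.var Y ∈ sub K ∨ pLmu.var Y ∈ sub K' := by simpa [sub] using h
    simp only [pLmu.freeVars, pLmu.binders, Set.mem_union, List.mem_append]
    rcases h with h | h
    · have := ih h; tauto
    · have := ih' h; tauto
  | mu X K ih =>
    have := ih (by simpa [sub] using h)
    simp only [pLmu.freeVars, pLmu.binders, Set.mem_sdiff, List.mem_cons, Set.mem_singleton_iff]
    tauto
  | nu X K ih =>
    have := ih (by simpa [sub] using h)
    simp only [pLmu.freeVars, pLmu.binders, Set.mem_sdiff, List.mem_cons, Set.mem_singleton_iff]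
    tauto

lemma sub_body {H : pLmu L} {Y : ℕ} {K : pLmu L} (h : pLmu.bodyOf H Y = some K) : K ∈ sub H := by
  induction H with
  | var X => simp [pLmu.bodyOf] at h
  | dia a G ih => exact Or.inr (ih h)
  | box a G ih => exact Or.inr (ih h)
  | or G G' ih ih' =>
    simp only [pLmu.bodyOf] at h
    cases h1 : pLmu.bodyOf G Y with
    | none => rw [h1] at h; exact Or.inr (Or.inr (ih' h))
    | some e' => rw [h1] at h; exact Or.inr (Or.inl (ih (h1.trans h)))
  | and G G' ih ih' =>
    simp only [pLmu.bodyOf] at h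
    cases h1 : pLmu.bodyOf G Y with
    | none => rw [h1] at h; exact Or.inr (Or.inr (ih' h))
    | some e' => rw [h1] at h; exact Or.inr (Or.inl (ih (h1.trans h)))
  | mu X G ih =>
    simp only [pLmu.bodyOf] at h
    split_ifs at h
    · simp at h; rw [← h]; exact Or.inr (sub_self _)
    · exact Or.inr (ih h)
  | nu X G ih =>
    simp only [pLmu.bodyOf] at h
    split_ifs at h
    · simp at h; rw [← h]; exact Or.inr (sub_self _)
    · exact Or.inr (ih h)

/-- fixed point binder, `true` for least -/
def fx : Bool → ℕ → pLmu L → pLmu L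
  | true => .mu
  | false => .nu

lemma fx_binders (m : Bool) (X : ℕ) (G : pLmu L) : (fx m X G).binders = X :: G.binders := by cases m <;> rfl
lemma fx_free (m : Bool) (X : ℕ) (G : pLmu L) : (fx m X G).freeVars = G.freeVars \ {X} := by cases m <;> rfl
lemma fx_size (m : Bool) (X : ℕ) (G : pLmu L) : (fx m X G).size = G.size + 1 := by cases m <;> rfl
lemma fx_body (m : Bool) (X : ℕ) (G : pLmu L) (Y : ℕ) :
    (fx m X G).bodyOf Y = if X = Y then some G else G.bodyOf Y := by cases m <;> rfl
lemma fx_info (m : Bool) (X : ℕ) (G : pLmu L) (d Y : ℕ) :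
    (fx m X G).varInfo d Y = if X = Y then some (d, m) else G.varInfo (d+1) Y := by cases m <;> rfl
lemma fx_sub (m : Bool) (X : ℕ) (G : pLmu L) : sub (fx m X G) = insert (fx m X G) (sub G) := by cases m <;> rfl

structure OK (F : pLmu L) (d : ℕ) (V : Set ℕ) (G : pLmu L) : Prop where
  body : ∀ Y ∈ G.binders, F.bodyOf Y = G.bodyOf Y
  info : ∀ Y ∈ G.binders, F.varInfo 0 Y = G.varInfo d Y
  nodup : G.binders.Nodup
  free : G.freeVars ⊆ V
  bound : ∀ X ∈ G.binders, X ∉ V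
  size : d + G.size ≤ F.size

lemma OK.dia {F : pLmu L} {d : ℕ} {V : Set ℕ} {a : L} {G : pLmu L} (h : OK F d V (.dia a G)) : OK F (d+1) V G :=
  ⟨h.body, h.info, h.nodup, h.free, h.bound, by have := h.size; simp [pLmu.size] at this; omega⟩

lemma OK.box {F : pLmu L} {d : ℕ} {V : Set ℕ} {a : L} {G : pLmu L} (h : OK F d V (.box a G)) : OK F (d+1) V G :=
  ⟨h.body, h.info, h.nodup, h.free, h.bound, by have := h.size; simp [pLmu.size] at this; omega⟩

lemma orElse_left {α : Type} {a b : Option α} (h : a ≠ none) : a.orElse (fun _ => b) = a := by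
  cases a with
  | none => exact absurd rfl h
  | some x => rfl

lemma orElse_right {α : Type} {a b : Option α} (h : a = none) : a.orElse (fun _ => b) = b := by
  rw [h]; rfl

lemma OK.or1 {F : pLmu L} {d : ℕ} {V : Set ℕ} {G H : pLmu L} (h : OK F d V (.or G H)) : OK F (d+1) V G := by
  have hm : ∀ Y ∈ G.binders, Y ∈ (pLmu.or G H).binders := fun Y hY => by simp [pLmu.binders, hY]
  refine ⟨fun Y hY => ?_, fun Y hY => ?_, (List.nodup_append.1 h.nodup).1,
    fun X hX => h.free (Or.inl hX), fun X hX => h.bound X (hm X hX), by have := h.size; simp [pLmu.size] at this; omega⟩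
  · rw [h.body Y (hm Y hY), pLmu.bodyOf, orElse_left (by rw [ne_eq, bodyOf_none]; simpa using hY)]
  · rw [h.info Y (hm Y hY), pLmu.varInfo, orElse_left (by rw [ne_eq, varInfo_none]; simpa using hY)]

lemma OK.or2 {F : pLmu L} {d : ℕ} {V : Set ℕ} {G H : pLmu L} (h : OK F d V (.or G H)) : OK F (d+1) V H := by
  have hm : ∀ Y ∈ H.binders, Y ∈ (pLmu.or G H).binders := fun Y hY => by simp [pLmu.binders, hY]
  have hn : ∀ Y ∈ H.binders, Y ∉ G.binders := fun Y hY hY' =>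
    (List.nodup_append.1 h.nodup).2.2 Y hY' Y hY rfl
  refine ⟨fun Y hY => ?_, fun Y hY => ?_, (List.nodup_append.1 h.nodup).2.1,
    fun X hX => h.free (Or.inr hX), fun X hX => h.bound X (hm X hX), by have := h.size; simp [pLmu.size] at this; omega⟩
  · rw [h.body Y (hm Y hY), pLmu.bodyOf, orElse_right (bodyOf_none.2 (hn Y hY))]
  · rw [h.info Y (hm Y hY), pLmu.varInfo, orElse_right ((varInfo_none _).2 (hn Y hY))]

lemma OK.and_or {F : pLmu L} {d : ℕ} {V : Set ℕ} {G H : pLmu L} (h : OK F d V (.and G H)) : OK F d V (.or G H) :=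
  ⟨h.body, h.info, h.nodup, h.free, h.bound, h.size⟩

lemma OK.fx {F : pLmu L} {d : ℕ} {V : Set ℕ} {m : Bool} {X : ℕ} {G : pLmu L} (h : OK F d V (fx m X G)) :
    OK F (d+1) (insert X V) G := by
  have hm : ∀ Y ∈ G.binders, Y ∈ (PL.fx m X G).binders := fun Y hY => by simp [fx_binders, hY]
  have hnd := h.nodup
  rw [fx_binders, List.nodup_cons] at hnd
  have hne : ∀ Y ∈ G.binders, X ≠ Y := fun Y hY e => hnd.1 (e ▸ hY)
  refine ⟨fun Y hY => ?_, fun Y hY => ?_, hnd.2, fun Y hY => ?_, fun Y hY => ?_, ?_⟩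
  · rw [h.body Y (hm Y hY), fx_body, if_neg (hne Y hY)]
  · rw [h.info Y (hm Y hY), fx_info, if_neg (hne Y hY)]
  · by_cases e : Y = X
    · exact Or.inl e
    · refine Or.inr (h.free ?_)
      rw [fx_free]; exact ⟨hY, e⟩
  · rintro (e | e)
    · exact hne Y hY e.symm
    · exact h.bound Y (hm Y hY) e
  · have := h.size; rw [fx_size] at this; omega

lemma OK.bodyX {F : pLmu L} {d : ℕ} {V : Set ℕ} {m : Bool} {X : ℕ} {G : pLmu L} (h : OK F d V (PL.fx m X G)) :
    F.bodyOf X = some G := by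
  rw [h.body X (by simp [fx_binders]), fx_body, if_pos rfl]

lemma OK.infoX {F : pLmu L} {d : ℕ} {V : Set ℕ} {m : Bool} {X : ℕ} {G : pLmu L} (h : OK F d V (PL.fx m X G)) :
    F.varInfo 0 X = some (d, m) := by
  rw [h.info X (by simp [fx_binders]), fx_info, if_pos rfl]

lemma OK.boundX {F : pLmu L} {d : ℕ} {V : Set ℕ} {m : Bool} {X : ℕ} {G : pLmu L} (h : OK F d V (PL.fx m X G)) :
    X ∉ V := h.bound X (by simp [fx_binders])

lemma OK.top {F : pLmu L} (hF : F.NormalForm) : OK F 0 {X | X ∉ F.binders} F :=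
  ⟨fun _ _ => rfl, fun _ _ => rfl, hF.1, fun X hX hX' => hF.2 X hX' hX, fun X hX h => h hX, by simp⟩

/-! ## arena -/

lemma dist_injective (G : pLmu L) : Function.Injective (fun q : P => ((Sum.inl q, G) : GState L P)) := by
  intro a b h
  simpa using h

lemma prob_inl (M : PLTS L P) (F : pLmu L) (d : PDist P) (G : pLmu L) (q : P) :
    (gameArena M F).prob (Sum.inr d, G) (Sum.inl q, G) = d.f q := by
  simp [gameArena]

lemma prob_ne (M : PLTS L P) (F : pLmu L) (d : PDist P) (G : pLmu L) (t : GState L P)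
    (ht : t ∉ Set.range (fun q : P => ((Sum.inl q, G) : GState L P))) :
    (gameArena M F).prob (Sum.inr d, G) t = 0 := by
  obtain ⟨q | d', G'⟩ := t
  · have : G' ≠ G := by rintro rfl; exact ht ⟨q, rfl⟩
    simp [gameArena, this]
  · rfl

lemma owner_nature {M : PLTS L P} {F : pLmu L} {s : GState L P} (h : (gameArena M F).owner s = Player.nature) :
    ∃ d G, s = (Sum.inr d, G) := by
  obtain ⟨q | d', G'⟩ := s
  · exfalso
    cases G' with
    | var X =>
      simp only [gameArena] at h
      rcases h1 : pLmu.varInfo F 0 X with _ | ⟨e, m⟩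
      · simp [h1] at h
      · cases m <;> simp [h1] at h
    | _ => simp [gameArena] at h
  · exact ⟨d', G', rfl⟩

lemma wf (M : PLTS L P) (F : pLmu L) : (gameArena M F).Wellformed := by
  intro s hs
  obtain ⟨d, G, rfl⟩ := owner_nature hs
  refine ⟨fun t => ?_, ?_, ?_⟩
  · by_cases h : t ∈ Set.range (fun q : P => ((Sum.inl q, G) : GState L P))
    · obtain ⟨q, rfl⟩ := h
      rw [prob_inl]; exact d.nonneg q
    · rw [prob_ne _ _ _ _ _ h]
  · refine ((dist_injective G).hasSum_iff (fun t ht => prob_ne M F d G t ht)).1 ?_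
    have : (gameArena M F).prob (Sum.inr d, G) ∘ (fun q : P => ((Sum.inl q, G) : GState L P)) = d.f := by
      funext q; exact prob_inl M F d G q
    rw [this]; exact d.sum_one
  · ext t
    change t ∈ (fun q => ((Sum.inl q : P ⊕ PDist P), G)) '' Function.support d.f ↔ _
    constructor
    · rintro ⟨q, hq, rfl⟩
      rw [Function.mem_support, prob_inl]; exact hq
    · intro h
      by_cases ht : t ∈ Set.range (fun q : P => ((Sum.inl q, G) : GState L P))
      · obtain ⟨q, rfl⟩ := ht
        rw [Function.mem_support, prob_inl] at h
        exact ⟨q, h, rfl⟩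
      · exact absurd (prob_ne _ _ _ _ _ ht) h

lemma owner_inl (M : PLTS L P) (F : pLmu L) (p : P) (G : pLmu L) :
    (gameArena M F).owner (Sum.inl p, G) ≠ Player.nature := by
  intro h
  obtain ⟨d, G, h⟩ := owner_nature h
  simp at h

lemma E_var (M : PLTS L P) {F : pLmu L} (p : P) {X : ℕ} {H : pLmu L} (h : F.bodyOf X = some H) :
    (gameArena M F).E (Sum.inl p, .var X) = {(Sum.inl p, H)} := by
  simp [gameArena, h]

lemma E_var_none (M : PLTS L P) {F : pLmu L} (p : P) {X : ℕ} (h : F.bodyOf X = none) :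
    (gameArena M F).E (Sum.inl p, .var X) = ∅ := by
  simp [gameArena, h]

lemma E_fx (M : PLTS L P) (F : pLmu L) (p : P) (m : Bool) (X : ℕ) (H : pLmu L) :
    (gameArena M F).E (Sum.inl p, fx m X H) = {(Sum.inl p, H)} := by
  cases m <;> rfl

lemma E_inr (M : PLTS L P) (F : pLmu L) (d : PDist P) (G : pLmu L) :
    (gameArena M F).E (Sum.inr d, G) = (fun q => ((Sum.inl q : P ⊕ PDist P), G)) '' Function.support d.f := rfl

lemma E_inr_ne (M : PLTS L P) (F : pLmu L) (d : PDist P) (G : pLmu L) :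
    (gameArena M F).E (Sum.inr d, G) ≠ ∅ := by
  rw [E_inr, ne_eq, Set.image_eq_empty, Function.support_eq_empty_iff]
  intro h
  have := d.sum_one
  rw [h] at this
  exact one_ne_zero (this.unique hasSum_zero)

/-- done states -/
def Dn (M : PLTS L P) (F : pLmu L) (V : Set ℕ) (s : GState L P) : Prop :=
  (gameArena M F).E s = ∅ ∨ ∃ p X, X ∈ V ∧ s = (Sum.inl p, .var X)

lemma Dn_insert (M : PLTS L P) (F : pLmu L) (V : Set ℕ) (X : ℕ) :
    Dn M F (insert X V) = fun s => Dn M F V s ∨ ∃ q, s = (Sum.inl q, .var X) := by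
  funext s
  apply propext
  simp only [Dn, Set.mem_insert_iff]
  constructor
  · rintro (h | ⟨p, Y, rfl | h, rfl⟩)
    · exact Or.inl (Or.inl h)
    · exact Or.inr ⟨p, rfl⟩
    · exact Or.inl (Or.inr ⟨p, Y, h, rfl⟩)
  · rintro ((h | ⟨p, Y, h, rfl⟩) | ⟨q, rfl⟩)
    · exact Or.inl h
    · exact Or.inr ⟨p, Y, Or.inr h, rfl⟩
    · exact Or.inr ⟨q, X, Or.inl rfl, rfl⟩

/-! ## parity -/

def pl (b : Bool) : Player := if b then Player.one else Player.two

def vl (b : Bool) (x : ℝ) : ℝ≥0∞ := ENNReal.ofReal (if b then 1 - x else x)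

def par (F : pLmu L) (b : Bool) (u : PathSpace (GState L P)) : ℝ≥0∞ :=
  vl b (if Even (sSup {n | {i | gamePri F (u i) = n}.Infinite}) then 1 else 0)

lemma vl_le (b : Bool) {x : ℝ} (h0 : 0 ≤ x) (h1 : x ≤ 1) : vl b x ≤ 1 := by
  rw [vl, ENNReal.ofReal_le_one]; split_ifs <;> linarith

lemma par_le (F : pLmu L) (b : Bool) (u : PathSpace (GState L P)) : par F b u ≤ 1 := by
  rw [par]; apply vl_le <;> split_ifs <;> simp

lemma par_cons (F : pLmu L) (b : Bool) (s : GState L P) (u : PathSpace (GState L P)) :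
    par F b (consP s u) = par F b u := by
  have : ∀ n, {i | gamePri F (consP s u i) = n}.Infinite ↔ {i | gamePri F (u i) = n}.Infinite := by
    intro n
    rw [Set.infinite_iff_exists_gt, Set.infinite_iff_exists_gt]
    constructor
    · intro h a
      obtain ⟨i, hi, hai⟩ := h (a+1)
      obtain ⟨i, rfl⟩ : ∃ j, i = j + 1 := ⟨i-1, by omega⟩
      exact ⟨i, hi, by omega⟩
    · intro h a
      obtain ⟨i, hi, hai⟩ := h a
      exact ⟨i+1, hi, by omega⟩
  simp only [par, this]

lemma pri_bd (F : pLmu L) (s : GState L P) : gamePri F s < 2 * F.size + 2 := by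
  obtain ⟨q | d', G'⟩ := s
  · cases G' with
    | var X =>
      simp only [gamePri]
      rcases h1 : pLmu.varInfo F 0 X with _ | ⟨e, m⟩
      · simp
      · cases m <;> simp <;> omega
    | _ => simp [gamePri]
  · simp [gamePri]

lemma meas_par (F : pLmu L) (b : Bool) : Measurable (par (P := P) F b) := by
  have : MeasurableSet {u : PathSpace (GState L P) | Even (sSup {n | {i | gamePri F (u i) = n}.Infinite})} := by
    have h1 : ∀ n, MeasurableSet {u : PathSpace (GState L P) | {i | gamePri F (u i) = n}.Infinite} := by
      intro n
      have : {u : PathSpace (GState L P) | {i | gamePri F (u i) = n}.Infinite} =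
          ⋂ a : ℕ, ⋃ i : ℕ, {u | gamePri F (u i) = n ∧ a < i} := by
        ext u
        simp only [Set.mem_ofPred_eq, Set.infinite_iff_exists_gt, Set.mem_iInter, Set.mem_iUnion]
      rw [this]
      exact MeasurableSet.iInter fun a => MeasurableSet.iUnion fun i =>
        (meas_ev (fun s => gamePri F s = n ∧ a < i) i)
    have h2 : {u : PathSpace (GState L P) | Even (sSup {n | {i | gamePri F (u i) = n}.Infinite})} =
        ⋃ T : Finset ℕ, {u | Even (sSup (T : Set ℕ)) ∧ ∀ n, n ∈ T ↔ {i | gamePri F (u i) = n}.Infinite} := by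
      ext u
      simp only [Set.mem_ofPred_eq, Set.mem_iUnion]
      constructor
      · intro h
        have hT : ((Finset.range (2 * F.size + 2)).filter (fun n => {i | gamePri F (u i) = n}.Infinite) : Set ℕ)
            = {n | {i | gamePri F (u i) = n}.Infinite} := by
          ext n
          simp only [Finset.coe_filter, Finset.mem_range, Set.mem_ofPred_eq, and_iff_right_iff_imp]
          intro hn
          obtain ⟨i, hi⟩ := hn.nonempty
          rw [← hi]; exact pri_bd F _
        refine ⟨(Finset.range (2 * F.size + 2)).filter (fun n => {i | gamePri F (u i) = n}.Infinite), ?_, ?_⟩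
        · rw [hT]; exact h
        · intro n
          rw [← Finset.mem_coe, hT]; rfl
      · rintro ⟨T, hT, h⟩
        have : (T : Set ℕ) = {n | {i | gamePri F (u i) = n}.Infinite} := by
          ext n; exact h n
        rw [← this]; exact hT
    rw [h2]
    refine MeasurableSet.iUnion fun T => ?_
    refine MeasurableSet.inter (MeasurableSet.const (Even (sSup (T : Set ℕ)))) ?_
    change MeasurableSet {u : PathSpace (GState L P) | ∀ n, n ∈ T ↔ {i | gamePri F (u i) = n}.Infinite}
    have : {u : PathSpace (GState L P) | ∀ n, n ∈ T ↔ {i | gamePri F (u i) = n}.Infinite} =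
        ⋂ n, {u : PathSpace (GState L P) | n ∈ T ↔ {i | gamePri F (u i) = n}.Infinite} := by
      ext u; simp
    rw [this]
    refine MeasurableSet.iInter fun n => ?_
    by_cases hn : n ∈ T
    · simpa [hn] using h1 n
    · have e : {u : PathSpace (GState L P) | n ∈ T ↔ {i | gamePri F (u i) = n}.Infinite} =
          {u : PathSpace (GState L P) | {i | gamePri F (u i) = n}.Infinite}ᶜ := by
        ext u; simp [hn]
      rw [e]; exact (h1 n).compl
  have e : par (P := P) F b = fun u => if Even (sSup {n | {i | gamePri F (u i) = n}.Infinite})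
      then vl b 1 else vl b 0 := by
    funext u; simp only [par]; split_ifs <;> rfl
  rw [e]; exact Measurable.ite this measurable_const measurable_const

lemma par_zero (M : PLTS L P) {F : pLmu L} {d : ℕ} {V : Set ℕ} {m : Bool} {X : ℕ} {G : pLmu L}
    (h : OK F d V (fx m X G)) (u : PathSpace (GState L P)) (p : P) (h0 : u 0 = (Sum.inl p, G))
    (hu : ∀ i, u (i+1) ∈ (gameArena M F).E (u i)) (hD : ∀ i, ¬ Dn M F V (u i))
    (hB : {i | ∃ q, u i = (Sum.inl q, .var X)}.Infinite) : par F (!m) u = 0 := by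
  have hvar : ∀ i, (u i).2 ∈ sub (fx m X G) → ∀ q Y, u i = (Sum.inl q, .var Y) → Y ∈ (fx m X G).binders := by
    intro i hi q Y e
    rw [e] at hi
    refine (sub_var hi).resolve_left ?_
    intro hf
    exact hD i (Or.inr ⟨q, Y, h.free hf, e⟩)
  have hsub : ∀ i, (u i).2 ∈ sub (fx m X G) := by
    intro i
    induction i with
    | zero => rw [h0, fx_sub]; exact Or.inr (sub_self G)
    | succ i ih =>
      have h1 := hu i
      have hv := hvar i ih
      have hs := sub_trans ih
      rcases e : u i with ⟨q | d', G'⟩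
      · rw [e] at h1 hs ih
        cases G' with
        | var Y =>
          have hY := hv q Y e
          rcases hb : (fx m X G).bodyOf Y with _ | K
          · exact absurd hY (bodyOf_none.1 hb)
          · rw [E_var M q ((h.body Y hY).trans hb)] at h1
            rw [show u (i+1) = (Sum.inl q, K) from h1]
            exact sub_body hb
        | dia a K =>
          obtain ⟨d', _, h1⟩ := h1
          rw [← h1]; exact hs (Or.inr (sub_self K))
        | box a K =>
          obtain ⟨d', _, h1⟩ := h1
          rw [← h1]; exact hs (Or.inr (sub_self K))
        | or K K' =>
          rcases h1 with h1 | h1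
          · rw [h1]; exact hs (Or.inr (Or.inl (sub_self K)))
          · rw [show u (i+1) = (Sum.inl q, K') from h1]; exact hs (Or.inr (Or.inr (sub_self K')))
        | and K K' =>
          rcases h1 with h1 | h1
          · rw [h1]; exact hs (Or.inr (Or.inl (sub_self K)))
          · rw [show u (i+1) = (Sum.inl q, K') from h1]; exact hs (Or.inr (Or.inr (sub_self K')))
        | mu Y K => rw [show u (i+1) = (Sum.inl q, K) from h1]; exact hs (Or.inr (sub_self K))
        | nu Y K => rw [show u (i+1) = (Sum.inl q, K) from h1]; exact hs (Or.inr (sub_self K))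
      · rw [e] at h1 ih
        obtain ⟨q, _, h1⟩ := h1
        rw [← h1]; exact ih
  have hsz := h.size
  rw [fx_size] at hsz
  let pX := if m then 2 * (F.size - d) + 1 else 2 * (F.size - d)
  have hpX : ∀ q : P, gamePri F ((Sum.inl q, .var X) : GState L P) = pX := by
    intro q
    simp only [gamePri, h.infoX, pX]
    cases m <;> rfl
  have hle : ∀ i, gamePri F (u i) ≤ pX := by
    intro i
    rcases e : u i with ⟨q | d', G'⟩
    · cases G' with
      | var Y =>
        by_cases hXY : Y = X
        · rw [hXY, hpX]
        · have hY := hvar i (hsub i) q Y e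
          have h2 := h.info Y hY
          rw [fx_info, if_neg (Ne.symm hXY)] at h2
          rw [gamePri, h2]
          rcases h3 : G.varInfo (d+1) Y with _ | ⟨d', m'⟩
          · simp
          · have := varInfo_ge _ _ h3
            simp only [pX] at *
            cases m <;> cases m' <;> simp <;> omega
      | _ => simp [gamePri]
    · simp [gamePri]
  have hsup : sSup {n | {i | gamePri F (u i) = n}.Infinite} = pX := by
    apply IsGreatest.csSup_eq
    constructor
    · refine hB.mono ?_
      rintro i ⟨q, hq⟩
      change gamePri F (u i) = pX
      rw [hq, hpX]
    · intro n hn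
      obtain ⟨i, hi⟩ := hn.nonempty
      rw [← hi]; exact hle i
  rw [par, hsup]
  cases m
  · have : Even pX := by simp [pX]
    simp [this, vl]
  · have : ¬ Even pX := by simp [pX]
    simp [this, vl]

end PL

namespace PL
open MeasureTheory ProbabilityTheory
open scoped ENNReal
variable {L P : Type}

def rr (F : pLmu L) (b : Bool) (ρ : ℕ → P → unitInterval) (s : GState L P) : ℝ≥0∞ := vl b (gameR F ρ s)

lemma gameR_mem (F : pLmu L) (ρ : ℕ → P → unitInterval) (s : GState L P) :
    0 ≤ gameR F ρ s ∧ gameR F ρ s ≤ 1 := by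
  obtain ⟨q | d', G'⟩ := s
  · cases G' <;> first | exact ⟨(ρ _ q).2.1, (ρ _ q).2.2⟩ | simp [gameR]
  · simp [gameR]

lemma rr_le (F : pLmu L) (b : Bool) (ρ : ℕ → P → unitInterval) (s : GState L P) : rr F b ρ s ≤ 1 :=
  vl_le b (gameR_mem F ρ s).1 (gameR_mem F ρ s).2

def Wc (M : PLTS L P) (F : pLmu L) (b : Bool) (V : Set ℕ) (ρ : ℕ → P → unitInterval) (s : GState L P) (y : ℝ≥0∞) : Prop :=
  ∀ ε : ℝ≥0∞, ε ≠ 0 → ε ≠ ⊤ →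
    W (gameArena M F) (pl b) (Dn M F V) (pay (Dn M F V) (rr F b ρ) (par F b)) s (y + ε)

lemma hPhi (M : PLTS L P) (F : pLmu L) (b : Bool) (V : Set ℕ) (ρ : ℕ → P → unitInterval) :
    ∀ s u, ¬ Dn M F V s → pay (Dn M F V) (rr F b ρ) (par F b) (consP s u) =
      pay (Dn M F V) (rr F b ρ) (par F b) u :=
  fun _ u hs => pay_step (par_cons F b) hs u

lemma pl_ne (b : Bool) : pl b ≠ Player.nature := by cases b <;> simp [pl]

lemma Wc_done {M : PLTS L P} {F : pLmu L} {b : Bool} {V : Set ℕ} {ρ : ℕ → P → unitInterval} {s : GState L P}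
    (hs : Dn M F V s) : Wc M F b V ρ s (rr F b ρ s) :=
  fun _ _ _ => W_mono (W_done hs) le_self_add

lemma Wc_mono {M : PLTS L P} {F : pLmu L} {b : Bool} {V : Set ℕ} {ρ : ℕ → P → unitInterval} {s : GState L P}
    {x y : ℝ≥0∞} (h : Wc M F b V ρ s x) (hxy : x ≤ y) : Wc M F b V ρ s y :=
  fun ε h1 h2 => W_mono (h ε h1 h2) (by gcongr)

lemma vl_mono {b : Bool} {x y : ℝ} (h : if b then y ≤ x else x ≤ y) : vl b x ≤ vl b y := by
  cases b
  · exact ENNReal.ofReal_le_ofReal (by simpa using h)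
  · refine ENNReal.ofReal_le_ofReal ?_
    simp only [if_true] at h ⊢
    linarith

lemma vl_mono_iff {b : Bool} {x y : unitInterval} : vl b x ≤ vl b y ↔ (if b then y ≤ x else x ≤ y) := by
  have h0 := x.2.1
  have h1 := x.2.2
  have h2 := y.2.1
  have h3 := y.2.2
  cases b
  · rw [vl, vl, ENNReal.ofReal_le_ofReal_iff (by simpa using h2)]; simp
  · rw [vl, vl, ENNReal.ofReal_le_ofReal_iff (by simpa using h3)]
    simp only [if_true, ← Subtype.coe_le_coe]
    constructor <;> intro h <;> linarith

lemma vl_add {b : Bool} {x y e : ℝ} (h : if b then y ≤ x + e else x ≤ y + e) :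
    vl b x ≤ vl b y + ENNReal.ofReal e := by
  refine le_trans ?_ ENNReal.ofReal_add_le
  apply ENNReal.ofReal_le_ofReal
  cases b
  · simpa using h
  · simp at h ⊢; linarith

lemma lub_approx {ι : Type} {J : Set ι} (hI : J.Nonempty) (x : ι → unitInterval) {y : unitInterval}
    (h : IsLUB (x '' J) y) {e : ℝ} (he : 0 < e) : ∃ i ∈ J, (y : ℝ) ≤ x i + e := by
  by_contra hc
  push Not at hc
  obtain ⟨i, hi⟩ := hI
  have h0 := (x i).2.1
  have h1 := hc i hi
  have h2 := y.2.2
  have hz : (y : ℝ) - e ∈ Set.Icc (0:ℝ) 1 := ⟨by linarith, by linarith⟩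
  have : y ≤ ⟨(y : ℝ) - e, hz⟩ := h.2 (by
    rintro _ ⟨j, hj, rfl⟩
    have := hc j hj
    change (x j : ℝ) ≤ y - e
    linarith)
  have h3 : (y : ℝ) ≤ y - e := this
  linarith

lemma glb_approx {ι : Type} {J : Set ι} (hI : J.Nonempty) (x : ι → unitInterval) {y : unitInterval}
    (h : IsGLB (x '' J) y) {e : ℝ} (he : 0 < e) : ∃ i ∈ J, (x i : ℝ) ≤ y + e := by
  by_contra hc
  push Not at hc
  obtain ⟨i, hi⟩ := hI
  have h0 := (x i).2.2
  have h1 := hc i hi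
  have h2 := y.2.1
  have hz : (y : ℝ) + e ∈ Set.Icc (0:ℝ) 1 := ⟨by linarith, by linarith⟩
  have : ⟨(y : ℝ) + e, hz⟩ ≤ y := h.2 (by
    rintro _ ⟨j, hj, rfl⟩
    have := hc j hj
    change (y : ℝ) + e ≤ x j
    linarith)
  have h3 : (y : ℝ) + e ≤ y := this
  linarith

lemma choice {M : PLTS L P} {F : pLmu L} {b : Bool} {V : Set ℕ} {ρ : ℕ → P → unitInterval} {s : GState L P}
    (c : Bool) (hs : ¬ Dn M F V s) (ho : (gameArena M F).owner s = pl c) {ι : Type} {J : Set ι} {f : ι → GState L P}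
    (hE : (gameArena M F).E s = f '' J) (x : ι → unitInterval) {y : unitInterval}
    (hy : if c then IsLUB (x '' J) y else IsGLB (x '' J) y)
    (hx : ∀ i ∈ J, Wc M F b V ρ (f i) (vl b (x i))) : Wc M F b V ρ s (vl b y) := by
  have hEn : (gameArena M F).E s ≠ ∅ := fun h => hs (Or.inl h)
  have hI : J.Nonempty := by
    rw [← Set.image_nonempty, ← hE]; exact Set.nonempty_iff_ne_empty.2 hEn
  by_cases hbc : b = c
  · subst hbc
    intro ε h1 h2
    have he : 0 < (ε / 2).toReal := ENNReal.toReal_pos (by simpa using h1) (ENNReal.div_ne_top h2 (by simp))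
    have : ∃ i ∈ J, vl b (x i) ≤ vl b y + ENNReal.ofReal (ε / 2).toReal := by
      cases b
      · obtain ⟨i, hi, h⟩ := glb_approx hI x (by simpa using hy) he
        exact ⟨i, hi, vl_add (by simpa using h)⟩
      · obtain ⟨i, hi, h⟩ := lub_approx hI x (by simpa using hy) he
        exact ⟨i, hi, vl_add (by simpa using h)⟩
    rw [ENNReal.ofReal_toReal (ENNReal.div_ne_top h2 (by simp))] at this
    obtain ⟨i, hi, h⟩ := this
    refine W_own (hPhi M F b V ρ) hs (c := f i) (by rw [hE]; exact ⟨i, hi, rfl⟩) ho (pl_ne b) ?_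
    refine W_mono (hx i hi (ε / 2) (by simpa using h1) (ENNReal.div_ne_top h2 (by simp))) ?_
    calc vl b (x i) + ε / 2 ≤ vl b y + ε / 2 + ε / 2 := by gcongr
      _ = vl b y + ε := by rw [add_assoc, ENNReal.add_halves]
  · intro ε h1 h2
    refine W_opp (hPhi M F b V ρ) hs hEn (by rw [ho]; exact pl_ne c) ?_
    rw [hE]
    rintro _ ⟨i, hi, rfl⟩
    refine Wc_mono (hx i hi) ?_ ε h1 h2
    rw [vl_mono_iff]
    cases b <;> cases c <;> simp at hbc hy ⊢
    · exact hy.1 ⟨i, hi, rfl⟩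
    · exact hy.1 ⟨i, hi, rfl⟩

lemma Wc_single {M : PLTS L P} {F : pLmu L} {b : Bool} {V : Set ℕ} {ρ : ℕ → P → unitInterval} {s t : GState L P}
    (hs : ¬ Dn M F V s) (ho : (gameArena M F).owner s ≠ Player.nature)
    (hE : (gameArena M F).E s = {t}) {y : ℝ≥0∞}
    (hx : W (gameArena M F) (pl b) (Dn M F V) (pay (Dn M F V) (rr F b ρ) (par F b)) t y) :
      W (gameArena M F) (pl b) (Dn M F V) (pay (Dn M F V) (rr F b ρ) (par F b)) s y := by
  refine W_opp (hPhi M F b V ρ) hs (by rw [hE]; simp) ho ?_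
  rw [hE]
  rintro _ rfl
  exact hx

lemma sum_mem (d : PDist P) (g : P → unitInterval) :
    Summable (fun q => d.f q * (g q : ℝ)) ∧ 0 ≤ ∑' q, d.f q * (g q : ℝ) ∧ ∑' q, d.f q * (g q : ℝ) ≤ 1 := by
  have h1 : ∀ q, 0 ≤ d.f q * (g q : ℝ) := fun q => mul_nonneg (d.nonneg q) (g q).2.1
  have h2 : ∀ q, d.f q * (g q : ℝ) ≤ d.f q := fun q => mul_le_of_le_one_right (d.nonneg q) (g q).2.2
  have h3 : Summable (fun q => d.f q * (g q : ℝ)) := Summable.of_nonneg_of_le h1 h2 d.sum_one.summable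
  refine ⟨h3, tsum_nonneg h1, ?_⟩
  rw [← d.sum_one.tsum_eq]
  exact h3.tsum_le_tsum h2 d.sum_one.summable

lemma distExp_coe (d : PDist P) (g : P → unitInterval) :
    (pLmu.distExp d g : ℝ) = ∑' q, d.f q * (g q : ℝ) := by
  rw [pLmu.distExp, Set.projIcc_of_mem zero_le_one ⟨(sum_mem d g).2.1, (sum_mem d g).2.2⟩]

lemma distExp_mono (d : PDist P) {g h : P → unitInterval} (hgh : g ≤ h) : pLmu.distExp d g ≤ pLmu.distExp d h := by
  rw [← Subtype.coe_le_coe, distExp_coe, distExp_coe]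
  exact (sum_mem d g).1.tsum_le_tsum (fun q => mul_le_mul_of_nonneg_left (hgh q) (d.nonneg q)) (sum_mem d h).1

lemma vl_distExp (b : Bool) (d : PDist P) (g : P → unitInterval) :
    vl b (pLmu.distExp d g) = ∑' q, ENNReal.ofReal (d.f q) * vl b (g q) := by
  have h1 : ∀ q, ENNReal.ofReal (d.f q) * vl b (g q) =
      ENNReal.ofReal (d.f q * (if b then 1 - (g q : ℝ) else g q)) := fun q => by
    rw [vl, ENNReal.ofReal_mul (d.nonneg q)]
  simp only [h1]
  have hs : HasSum (fun q => d.f q * (if b then 1 - (g q : ℝ) else g q))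
      (if b then 1 - (pLmu.distExp d g : ℝ) else pLmu.distExp d g) := by
    cases b
    · simpa [distExp_coe] using (sum_mem d g).1.hasSum
    · have := d.sum_one.sub (sum_mem d g).1.hasSum
      simpa [distExp_coe, mul_sub] using this
  rw [← ENNReal.ofReal_tsum_of_nonneg _ hs.summable, hs.tsum_eq, vl]
  intro q
  refine mul_nonneg (d.nonneg q) ?_
  have h0 := (g q).2.1
  have h1 := (g q).2.2
  split_ifs
  · linarith
  · exact h0

lemma Wc_nat {M : PLTS L P} {F : pLmu L} {b : Bool} {V : Set ℕ} {ρ : ℕ → P → unitInterval} (d : PDist P)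
    (G : pLmu L) (g : P → unitInterval) (h : ∀ q, Wc M F b V ρ (Sum.inl q, G) (vl b (g q))) :
    Wc M F b V ρ (Sum.inr d, G) (vl b (pLmu.distExp d g)) := by
  intro ε h1 h2
  have hs : ¬ Dn M F V ((Sum.inr d, G) : GState L P) := by
    rintro (h | ⟨p, X, _, h⟩)
    · exact E_inr_ne M F d G h
    · simp at h
  have := W_nat (wf M F) (hPhi M F b V ρ) hs (E_inr_ne M F d G) rfl (pl_ne b)
    (fun t => match t with | (Sum.inl q, _) => vl b (g q) + ε | _ => 0) (by
      rw [E_inr]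
      rintro _ ⟨q, _, rfl⟩
      exact h q ε h1 h2)
  refine W_mono this ?_
  rw [← (dist_injective G).tsum_eq]
  · simp only [prob_inl, mul_add]
    rw [ENNReal.tsum_add, vl_distExp, ENNReal.tsum_mul_right, ← ENNReal.ofReal_tsum_of_nonneg d.nonneg d.sum_one.summable,
      d.sum_one.tsum_eq]
    simp
  · intro t ht
    by_contra hc
    exact ht (by simp [prob_ne M F d G t hc])

lemma sem_mono (M : PLTS L P) (G : pLmu L) : ∀ {ρ ρ' : ℕ → P → unitInterval}, ρ ≤ ρ' → pLmu.sem M G ρ ≤ pLmu.sem M G ρ' := by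
  induction G with
  | var X => intro ρ ρ' h p; exact h X p
  | dia a G ih =>
    intro ρ ρ' h p
    simp only [pLmu.sem]
    refine sSup_le ?_
    rintro _ ⟨d, hd, rfl⟩
    exact (distExp_mono d (ih h)).trans (le_sSup ⟨d, hd, rfl⟩)
  | box a G ih =>
    intro ρ ρ' h p
    simp only [pLmu.sem]
    refine le_sInf ?_
    rintro _ ⟨d, hd, rfl⟩
    exact le_trans (sInf_le (Set.mem_image_of_mem _ hd)) (distExp_mono d (ih h))
  | or G H ih1 ih2 => intro ρ ρ' h p; exact sup_le_sup (ih1 h p) (ih2 h p)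
  | and G H ih1 ih2 => intro ρ ρ' h p; exact inf_le_inf (ih1 h p) (ih2 h p)
  | mu X G ih =>
    intro ρ ρ' h
    have : ∀ g, Function.update ρ X g ≤ Function.update ρ' X g := fun g => update_le_update_iff.2 ⟨le_rfl, fun _ _ => h _⟩
    exact sInf_le_sInf fun g hg => (ih (this g)).trans hg
  | nu X G ih =>
    intro ρ ρ' h
    have : ∀ g, Function.update ρ X g ≤ Function.update ρ' X g := fun g => update_le_update_iff.2 ⟨le_rfl, fun _ _ => h _⟩
    exact sSup_le_sSup fun g hg => le_trans hg (ih (this g))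

/-- Knaster-Tarski -/
lemma sem_fix (M : PLTS L P) (m : Bool) (X : ℕ) (G : pLmu L) (ρ : ℕ → P → unitInterval) (q : P) :
    vl (!m) (pLmu.sem M G (Function.update ρ X (pLmu.sem M (fx m X G) ρ)) q) ≤ vl (!m) (pLmu.sem M (fx m X G) ρ q) := by
  rw [vl_mono_iff]
  cases m
  · simp only [Bool.not_false, if_true]
    have : pLmu.sem M (fx false X G) ρ ≤ pLmu.sem M G (Function.update ρ X (pLmu.sem M (fx false X G) ρ)) := by
      change sSup {g : P → unitInterval | g ≤ pLmu.sem M G (Function.update ρ X g)} ≤ _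
      refine sSup_le fun g hg => le_trans hg ?_
      refine sem_mono M G (update_le_update_iff.2 ⟨?_, fun _ _ => le_rfl⟩)
      exact le_sSup (α := P → unitInterval) hg
    exact this q
  · simp only [Bool.not_true, if_false, Bool.false_eq_true]
    have : pLmu.sem M G (Function.update ρ X (pLmu.sem M (fx true X G) ρ)) ≤ pLmu.sem M (fx true X G) ρ := by
      change _ ≤ sInf {g : P → unitInterval | pLmu.sem M G (Function.update ρ X g) ≤ g}
      refine le_sInf fun g hg => le_trans ?_ hg
      refine sem_mono M G (update_le_update_iff.2 ⟨?_, fun _ _ => le_rfl⟩)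
      exact sInf_le (α := P → unitInterval) hg
    exact this q

lemma sem_bound (M : PLTS L P) (m : Bool) (X : ℕ) (G : pLmu L) (ρ : ℕ → P → unitInterval) (f : P → unitInterval)
    (h : ∀ q, vl m (f q) ≤ vl m (pLmu.sem M G (Function.update ρ X f) q)) (q : P) :
    vl m (f q) ≤ vl m (pLmu.sem M (fx m X G) ρ q) := by
  rw [vl_mono_iff]
  simp only [vl_mono_iff] at h
  cases m
  · simp only [if_false, Bool.false_eq_true] at h ⊢
    have : f ≤ sSup {g : P → unitInterval | g ≤ pLmu.sem M G (Function.update ρ X g)} := le_sSup h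
    exact this q
  · simp only [if_true] at h ⊢
    have : sInf {g : P → unitInterval | pLmu.sem M G (Function.update ρ X g) ≤ g} ≤ f := sInf_le h
    exact this q

end PL

namespace PL
open MeasureTheory ProbabilityTheory
open scoped ENNReal
variable {L P : Type}

lemma not_Dn_var (M : PLTS L P) {F : pLmu L} {d : ℕ} {V : Set ℕ} {m : Bool} {X : ℕ} {G : pLmu L}
    (h : OK F d V (fx m X G)) (q : P) : ¬ Dn M F V ((Sum.inl q, .var X) : GState L P) := by
  rintro (h1 | ⟨p, Y, hY, h1⟩)
  · rw [E_var M q h.bodyX] at h1; simp at h1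
  · simp only [Prod.mk.injEq, pLmu.var.injEq] at h1
    rw [← h1.2] at hY; exact h.boundX hY

lemma not_Dn_fx (M : PLTS L P) (F : pLmu L) (V : Set ℕ) (m : Bool) (X : ℕ) (G : pLmu L)
    (q : P) : ¬ Dn M F V ((Sum.inl q, fx m X G) : GState L P) := by
  rintro (h1 | ⟨p, Y, hY, h1⟩)
  · rw [E_fx] at h1; simp at h1
  · cases m <;> simp [fx] at h1

lemma rr_update (M : PLTS L P) {F : pLmu L} {d : ℕ} {V : Set ℕ} {m : Bool} {X : ℕ} {G : pLmu L}
    (h : OK F d V (fx m X G)) (b : Bool) (ρ : ℕ → P → unitInterval) (f : P → unitInterval)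
    (s : GState L P) (hs : Dn M F V s) : rr F b ρ s ≤ rr F b (Function.update ρ X f) s := by
  refine le_of_eq ?_
  obtain ⟨q | d', G'⟩ := s
  · cases G' with
    | var Y =>
      have : Y ≠ X := by rintro rfl; exact not_Dn_var M h q hs
      simp [rr, gameR, Function.update_of_ne this]
    | _ => rfl
  · rfl

lemma rr_varX (F : pLmu L) (b : Bool) (ρ : ℕ → P → unitInterval) (X : ℕ) (f : P → unitInterval) (q : P) :
    rr F b (Function.update ρ X f) (Sum.inl q, .var X) = vl b (f q) := by
  simp [rr, gameR]

lemma good (M : PLTS L P) {F : pLmu L} {d : ℕ} {V : Set ℕ} {m : Bool} {X : ℕ} {G : pLmu L}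
    (h : OK F d V (fx m X G))
    (ih : ∀ (ρ : ℕ → P → unitInterval) p, Wc M F (!m) (insert X V) ρ (Sum.inl p, G) (vl (!m) (pLmu.sem M G ρ p)))
    (ρ : ℕ → P → unitInterval) (p : P) :
    Wc M F (!m) V ρ (Sum.inl p, fx m X G) (vl (!m) (pLmu.sem M (fx m X G) ρ p)) := by
  intro ε h1 h2
  refine Wc_single (not_Dn_fx M F V m X G p) (owner_inl M F p _) (E_fx M F p m X G) ?_
  have h1' : ε / 2 ≠ 0 := by simpa using h1
  have h2' : ε / 2 ≠ ⊤ := ENNReal.div_ne_top h2 (by simp)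
  have key := fun q =>
    Wc_mono (ih (Function.update ρ X (pLmu.sem M (fx m X G) ρ)) q) (sem_fix M m X G ρ q)
  simp only [Wc, Dn_insert] at key
  have := W_inf (par_cons F (!m)) (meas_par F (!m)) (c := 1) (by simp) h2' h1' (rr_le F (!m) ρ)
    (rr_le F (!m) (Function.update ρ X (pLmu.sem M (fx m X G) ρ))) (par_le F (!m))
    (rr_update M h (!m) ρ _) (fun s => (s.1, G))
    (B := fun s => ∃ q, s = (Sum.inl q, .var X))
    (by rintro _ ⟨q, rfl⟩; exact not_Dn_var M h q)
    (by rintro _ ⟨q, rfl⟩; exact E_var M q h.bodyX)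
    (by rintro _ ⟨q, rfl⟩; exact owner_inl M F q _)
    (by
      rintro _ ⟨q, rfl⟩ δ hδ hδ'
      rw [rr_varX]
      exact key q δ hδ hδ')
    (by
      intro N
      filter_upwards [ae_zero N (Sum.inl p, G), ae_path (wf M F) N (Sum.inl p, G)] with u hu0 hu hD hB
      exact par_zero M h u p hu0 (fun i => (hu i).resolve_right fun hc => hD i (Or.inl hc)) hD hB)
    (key p (ε / 2) h1' h2')
  rwa [add_assoc, ENNReal.add_halves] at this

lemma exists_vl (b : Bool) {w : ℝ≥0∞} (hw : w ≤ 1) : ∃ x : unitInterval, vl b x = w := by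
  have hw' : w ≠ ⊤ := ne_top_of_le_ne_top (by simp) hw
  have h0 : 0 ≤ w.toReal := ENNReal.toReal_nonneg
  have h1 : w.toReal ≤ 1 := ENNReal.toReal_le_of_le_ofReal (by simp) (by simpa using hw)
  cases b
  · exact ⟨⟨w.toReal, h0, h1⟩, by simp [vl, hw']⟩
  · exact ⟨⟨1 - w.toReal, by linarith, by linarith⟩, by simp [vl, hw']⟩

lemma bad (M : PLTS L P) {F : pLmu L} {d : ℕ} {V : Set ℕ} {m : Bool} {X : ℕ} {G : pLmu L}
    (h : OK F d V (fx m X G))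
    (ih : ∀ (ρ : ℕ → P → unitInterval) p, Wc M F m (insert X V) ρ (Sum.inl p, G) (vl m (pLmu.sem M G ρ p)))
    (ρ : ℕ → P → unitInterval) (p : P) :
    Wc M F m V ρ (Sum.inl p, fx m X G) (vl m (pLmu.sem M (fx m X G) ρ p)) := by
  have hw1 : ∀ q : P, sInf {v | W (gameArena M F) (pl m) (Dn M F V) (pay (Dn M F V) (rr F m ρ) (par F m)) (Sum.inl q, G) v} ≤ 1 := by
    intro q
    refine sInf_le ⟨defS _ _, fun N _ => ?_⟩
    rw [← Ex_const N (Sum.inl q, G) 1]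
    refine Ex_mono fun u => ?_
    rw [pay]; split_ifs
    · exact rr_le _ _ _ _
    · exact par_le _ _ _
  choose f hf using fun q => exists_vl m (hw1 q)
  have approx : ∀ q ε, ε ≠ 0 → ε ≠ ⊤ →
      W (gameArena M F) (pl m) (Dn M F V) (pay (Dn M F V) (rr F m ρ) (par F m)) (Sum.inl q, G) (vl m (f q) + ε) := by
    intro q ε h1 h2
    have : sInf {v | W (gameArena M F) (pl m) (Dn M F V) (pay (Dn M F V) (rr F m ρ) (par F m)) (Sum.inl q, G) v}
        < vl m (f q) + ε := by
      rw [← hf]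
      exact ENNReal.lt_add_right (by simp [vl]) h1
    obtain ⟨v, hv, hlt⟩ := sInf_lt_iff.1 this
    exact W_mono hv hlt.le
  have main : ∀ q, vl m (f q) ≤ vl m (pLmu.sem M G (Function.update ρ X f) q) := by
    intro q
    refine ENNReal.le_of_forall_pos_le_add fun e he _ => ?_
    have h1' : (e / 2 : ℝ≥0∞) ≠ 0 := by simpa using he.ne'
    have h2' : (e / 2 : ℝ≥0∞) ≠ ⊤ := ENNReal.div_ne_top (by simp) (by simp)
    have key := ih (Function.update ρ X f) q (e / 2) h1' h2'
    simp only [Dn_insert] at key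
    have := W_glue (par_cons F m) (meas_par F m) (c := 1) (ε := e / 2) (by simp) h2' (rr_le F m ρ)
      (rr_le F m (Function.update ρ X f)) (par_le F m)
      (rr_update M h m ρ f) (B := fun s => ∃ q, s = (Sum.inl q, .var X))
      (by
        rintro _ ⟨q', rfl⟩
        rw [rr_varX]
        exact Wc_single (not_Dn_var M h q') (owner_inl M F q' _) (E_var M q' h.bodyX) (approx q' _ h1' h2'))
      key
    rw [add_assoc, ENNReal.add_halves] at this
    rw [hf]
    exact sInf_le this
  have hb := sem_bound M m X G ρ f main p
  intro ε h1 h2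
  refine Wc_single (not_Dn_fx M F V m X G p) (owner_inl M F p _) (E_fx M F p m X G) ?_
  exact W_mono (approx p ε h1 h2) (by gcongr)

lemma Wc_fx (M : PLTS L P) {F : pLmu L} (b : Bool) {d : ℕ} {V : Set ℕ} {m : Bool} {X : ℕ} {G : pLmu L}
    (h : OK F d V (fx m X G))
    (ih : ∀ (ρ : ℕ → P → unitInterval) p, Wc M F b (insert X V) ρ (Sum.inl p, G) (vl b (pLmu.sem M G ρ p)))
    (ρ : ℕ → P → unitInterval) (p : P) :
    Wc M F b V ρ (Sum.inl p, fx m X G) (vl b (pLmu.sem M (fx m X G) ρ p)) := by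
  by_cases hb : b = m
  · subst hb; exact bad M h ih ρ p
  · have : b = !m := by cases b <;> cases m <;> simp at hb ⊢
    subst this; exact good M h ih ρ p

theorem main_ind (M : PLTS L P) (F : pLmu L) (b : Bool) (G : pLmu L) : ∀ (d : ℕ) (V : Set ℕ), OK F d V G →
    ∀ (ρ : ℕ → P → unitInterval) (p : P), Wc M F b V ρ (Sum.inl p, G) (vl b (pLmu.sem M G ρ p)) := by
  induction G with
  | var X =>
    intro d V h ρ p
    exact Wc_done (Or.inr ⟨p, X, h.free rfl, rfl⟩)
  | dia a G ih =>
    intro d V h ρ p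
    by_cases he : M.trans a p = ∅
    · have := Wc_done (M := M) (F := F) (b := b) (V := V) (ρ := ρ) (s := (Sum.inl p, .dia a G))
        (Or.inl (by simp [gameArena, he]))
      convert this using 2
      simp [pLmu.sem, he, rr, gameR]
    · refine choice true ?_ rfl (f := fun d => ((Sum.inr d : P ⊕ PDist P), G)) rfl
        (fun d => pLmu.distExp d (pLmu.sem M G ρ)) (isLUB_sSup _) ?_
      · rintro (h1 | ⟨p, Y, hY, h1⟩)
        · exact he (by simpa [gameArena] using h1)
        · simp at h1
      · intro d' _
        exact Wc_nat d' G _ fun q => ih _ _ h.dia ρ q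
  | box a G ih =>
    intro d V h ρ p
    by_cases he : M.trans a p = ∅
    · have := Wc_done (M := M) (F := F) (b := b) (V := V) (ρ := ρ) (s := (Sum.inl p, .box a G))
        (Or.inl (by simp [gameArena, he]))
      convert this using 2
      simp [pLmu.sem, he, rr, gameR]
    · refine choice false ?_ rfl (f := fun d => ((Sum.inr d : P ⊕ PDist P), G)) rfl
        (fun d => pLmu.distExp d (pLmu.sem M G ρ)) (isGLB_sInf _) ?_
      · rintro (h1 | ⟨p, Y, hY, h1⟩)
        · exact he (by simpa [gameArena] using h1)
        · simp at h1
      · intro d' _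
        exact Wc_nat d' G _ fun q => ih _ _ h.box ρ q
  | or G H ih1 ih2 =>
    intro d V h ρ p
    refine choice true ?_ rfl (J := ({true, false} : Set Bool)) (f := fun c => ((Sum.inl p : P ⊕ PDist P), if c then G else H)) ?_
        (fun c => if c then pLmu.sem M G ρ p else pLmu.sem M H ρ p) ?_ ?_
    · rintro (h1 | ⟨p, Y, hY, h1⟩)
      · exact (Set.insert_nonempty _ _).ne_empty h1
      · simp at h1
    · simp [gameArena, Set.image_pair]
    · simp only [Set.image_pair, if_true, if_false, Bool.false_eq_true]
      exact isLUB_pair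
    · rintro c -
      cases c
      · exact ih2 _ _ h.or2 ρ p
      · exact ih1 _ _ h.or1 ρ p
  | and G H ih1 ih2 =>
    intro d V h ρ p
    refine choice false ?_ rfl (J := ({true, false} : Set Bool)) (f := fun c => ((Sum.inl p : P ⊕ PDist P), if c then G else H)) ?_
        (fun c => if c then pLmu.sem M G ρ p else pLmu.sem M H ρ p) ?_ ?_
    · rintro (h1 | ⟨p, Y, hY, h1⟩)
      · exact (Set.insert_nonempty _ _).ne_empty h1
      · simp at h1
    · simp [gameArena, Set.image_pair]
    · simp only [Set.image_pair, if_true, if_false, Bool.false_eq_true]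
      exact isGLB_pair
    · rintro c -
      cases c
      · exact ih2 _ _ h.and_or.or2 ρ p
      · exact ih1 _ _ h.and_or.or1 ρ p
  | mu X G ih =>
    intro d V h ρ p
    have h' : OK F d V (fx true X G) := h
    exact Wc_fx M b h' (ih _ _ h'.fx) ρ p
  | nu X G ih =>
    intro d V h ρ p
    have h' : OK F d V (fx false X G) := h
    exact Wc_fx M b h' (ih _ _ h'.fx) ρ p

lemma Dn_top (M : PLTS L P) (F : pLmu L) : Dn M F {X | X ∉ F.binders} = fun s => (gameArena M F).E s = ∅ := by
  funext s
  apply propext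
  refine ⟨?_, Or.inl⟩
  rintro (h | ⟨p, X, hX, rfl⟩)
  · exact h
  · exact E_var_none M p (bodyOf_none.2 hX)

lemma pay_top (M : PLTS L P) (F : pLmu L) (b : Bool) (ρ : ℕ → P → unitInterval) (u : PathSpace (GState L P)) :
    pay (fun s => (gameArena M F).E s = ∅) (rr F b ρ) (par F b) u =
      vl b (payoff (gameArena M F) (gamePri F) (gameR F ρ) u) := by
  by_cases h : ∃ i, (gameArena M F).E (u i) = ∅
  · rw [pay, payoff, dif_pos h, dif_pos h]; rfl
  · rw [pay, payoff, dif_neg h, dif_neg h]; rfl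

lemma payoff_mem (M : PLTS L P) (F : pLmu L) (ρ : ℕ → P → unitInterval) (u : PathSpace (GState L P)) :
    0 ≤ payoff (gameArena M F) (gamePri F) (gameR F ρ) u ∧ payoff (gameArena M F) (gamePri F) (gameR F ρ) u ≤ 1 := by
  rw [payoff]; split_ifs
  · exact gameR_mem _ _ _
  · simp
  · simp

lemma payoff_meas (M : PLTS L P) (F : pLmu L) (ρ : ℕ → P → unitInterval) :
    Measurable (payoff (gameArena M F) (gamePri F) (gameR F ρ)) := by
  have h := (meas_pay (fun s => (gameArena M F).E s = ∅) (rr F false ρ) (meas_par F false)).ennreal_toReal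
  convert h using 1
  funext u
  rw [pay_top]
  simp [vl, (payoff_mem M F ρ u).1]

lemma payoff_int (M : PLTS L P) (F : pLmu L) (ρ : ℕ → P → unitInterval) (N : Prof (gameArena M F)) (s : GState L P) :
    Integrable (payoff (gameArena M F) (gamePri F) (gameR F ρ)) (PM N s) := by
  refine Integrable.of_bound (payoff_meas M F ρ).aestronglyMeasurable 1 (Filter.Eventually.of_forall fun u => ?_)
  rw [Real.norm_eq_abs, abs_of_nonneg (payoff_mem M F ρ u).1]
  exact (payoff_mem M F ρ u).2

lemma exp_mem (M : PLTS L P) (F : pLmu L) (ρ : ℕ → P → unitInterval) (σ1 : Strategy (gameArena M F) Player.one)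
    (σ2 : Strategy (gameArena M F) Player.two) (s : GState L P) :
    0 ≤ expReward (gameArena M F) (gamePri F) (gameR F ρ) σ1 σ2 s ∧
      expReward (gameArena M F) (gamePri F) (gameR F ρ) σ1 σ2 s ≤ 1 := by
  rw [expReward, pathMeasure_eq (wf M F)]
  refine ⟨integral_nonneg fun u => (payoff_mem M F ρ u).1, ?_⟩
  have := integral_mono (payoff_int M F ρ (comb σ1 σ2) s) (integrable_const (1:ℝ)) fun u => (payoff_mem M F ρ u).2
  simpa using this

lemma exp_eq (M : PLTS L P) (F : pLmu L) (b : Bool) (ρ : ℕ → P → unitInterval) (σ1 : Strategy (gameArena M F) Player.one)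
    (σ2 : Strategy (gameArena M F) Player.two) (s : GState L P) :
    Ex (comb σ1 σ2) s (pay (fun s => (gameArena M F).E s = ∅) (rr F b ρ) (par F b)) =
      vl b (expReward (gameArena M F) (gamePri F) (gameR F ρ) σ1 σ2 s) := by
  rw [expReward, pathMeasure_eq (wf M F), Ex]
  simp only [pay_top]
  have hi := payoff_int M F ρ (comb σ1 σ2) s
  cases b
  · simp only [vl, if_false, Bool.false_eq_true]
    rw [ofReal_integral_eq_lintegral_ofReal hi (Filter.Eventually.of_forall fun u => (payoff_mem M F ρ u).1)]
  · simp only [vl, if_true]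
    have h1 := ofReal_integral_eq_lintegral_ofReal ((integrable_const (1:ℝ)).sub hi)
      (Filter.Eventually.of_forall fun u => sub_nonneg.2 (payoff_mem M F ρ u).2)
    refine h1.symm.trans ?_
    congr 1
    refine (integral_sub (integrable_const (1:ℝ)) hi).trans ?_
    simp

lemma vl_le_add {b : Bool} {x : ℝ} {y : unitInterval} {e : ℝ} (he : 0 < e) (h : vl b x ≤ vl b y + ENNReal.ofReal e) :
    if b then (y : ℝ) - e ≤ x else x ≤ y + e := by
  have h0 := y.2.1
  have h1 := y.2.2
  cases b
  · simp only [vl, if_false, Bool.false_eq_true] at h ⊢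
    rwa [← ENNReal.ofReal_add h0 he.le, ENNReal.ofReal_le_ofReal_iff (by linarith)] at h
  · simp only [vl, if_true] at h ⊢
    rw [← ENNReal.ofReal_add (by linarith) he.le, ENNReal.ofReal_le_ofReal_iff (by linarith)] at h
    linarith

theorem strat (M : PLTS L P) {F : pLmu L} (hF : F.NormalForm) (b : Bool) (ρ : ℕ → P → unitInterval) (p : P) {e : ℝ}
    (he : 0 < e) : ∃ ς : Strategy (gameArena M F) (pl b), ∀ σ1 σ2,
      (∀ l x, (gameArena M F).owner x = pl b → (comb σ1 σ2).next l x = ς.next l x) →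
      if b then (pLmu.sem M F ρ p : ℝ) - e ≤ expReward (gameArena M F) (gamePri F) (gameR F ρ) σ1 σ2 (Sum.inl p, F)
      else expReward (gameArena M F) (gamePri F) (gameR F ρ) σ1 σ2 (Sum.inl p, F) ≤ (pLmu.sem M F ρ p : ℝ) + e := by
  have h := main_ind M F b F 0 _ (OK.top hF) ρ p (ENNReal.ofReal e) (by simpa using he) (by simp)
  rw [Dn_top] at h
  obtain ⟨ς, hς⟩ := h
  refine ⟨ς, fun σ1 σ2 hc => ?_⟩
  have := hς (comb σ1 σ2) (fun l x _ _ _ ho _ => hc l x ho)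
  rw [exp_eq] at this
  exact vl_le_add he this

theorem final (M : PLTS L P) (F : pLmu L) (hF : F.NormalForm) (ρ : ℕ → P → unitInterval) (p : P) :
    (pLmu.sem M F ρ p : ℝ) =
        lowerValue (gameArena M F) (gamePri F) (gameR F ρ) (Sum.inl p, F) ∧
      lowerValue (gameArena M F) (gamePri F) (gameR F ρ) (Sum.inl p, F) =
        upperValue (gameArena M F) (gamePri F) (gameR F ρ) (Sum.inl p, F) := by
  haveI : Nonempty (Strategy (gameArena M F) Player.one) := ⟨defS _ _⟩
  haveI : Nonempty (Strategy (gameArena M F) Player.two) := ⟨defS _ _⟩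
  have hm := fun σ1 σ2 => exp_mem M F ρ σ1 σ2 (Sum.inl p, F)
  have b1 : ∀ σ1, BddBelow (Set.range fun σ2 => expReward (gameArena M F) (gamePri F) (gameR F ρ) σ1 σ2 (Sum.inl p, F)) :=
    fun σ1 => ⟨0, by rintro _ ⟨σ2, rfl⟩; exact (hm σ1 σ2).1⟩
  have b2 : ∀ σ2, BddAbove (Set.range fun σ1 => expReward (gameArena M F) (gamePri F) (gameR F ρ) σ1 σ2 (Sum.inl p, F)) :=
    fun σ2 => ⟨1, by rintro _ ⟨σ1, rfl⟩; exact (hm σ1 σ2).2⟩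
  have b3 : BddAbove (Set.range fun σ1 => ⨅ σ2, expReward (gameArena M F) (gamePri F) (gameR F ρ) σ1 σ2 (Sum.inl p, F)) :=
    ⟨1, by rintro _ ⟨σ1, rfl⟩; exact (ciInf_le (b1 σ1) (defS _ _)).trans (hm σ1 _).2⟩
  have b4 : BddBelow (Set.range fun σ2 => ⨆ σ1, expReward (gameArena M F) (gamePri F) (gameR F ρ) σ1 σ2 (Sum.inl p, F)) :=
    ⟨0, by rintro _ ⟨σ2, rfl⟩; exact (hm _ σ2).1.trans (le_ciSup (b2 σ2) (defS _ _))⟩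
  have h1 : lowerValue (gameArena M F) (gamePri F) (gameR F ρ) (Sum.inl p, F) ≤
      upperValue (gameArena M F) (gamePri F) (gameR F ρ) (Sum.inl p, F) :=
    ciSup_le fun σ1 => le_ciInf fun σ2 => (ciInf_le (b1 σ1) σ2).trans (le_ciSup (b2 σ2) σ1)
  have h2 : (pLmu.sem M F ρ p : ℝ) ≤ lowerValue (gameArena M F) (gamePri F) (gameR F ρ) (Sum.inl p, F) := by
    refine le_of_forall_pos_le_add fun e he => ?_
    obtain ⟨ς, hς⟩ := strat M hF true ρ p he
    have h3 : (pLmu.sem M F ρ p : ℝ) - e ≤ lowerValue (gameArena M F) (gamePri F) (gameR F ρ) (Sum.inl p, F) := by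
      refine le_trans ?_ (le_ciSup b3 ς)
      refine le_ciInf fun σ2 => ?_
      have := hς ς σ2 (fun l x ho => by
        have ho' : (gameArena M F).owner x = Player.one := ho
        simp only [comb, ho', if_true])
      simpa using this
    linarith
  have h3 : upperValue (gameArena M F) (gamePri F) (gameR F ρ) (Sum.inl p, F) ≤ (pLmu.sem M F ρ p : ℝ) := by
    refine le_of_forall_pos_le_add fun e he => ?_
    obtain ⟨ς, hς⟩ := strat M hF false ρ p he
    refine (ciInf_le b4 ς).trans ?_
    refine ciSup_le fun σ1 => ?_
    have := hς σ1 ς (fun l x ho => by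
      have ho' : (gameArena M F).owner x = Player.two := ho
      simp [comb, ho'])
    simpa using this
  exact ⟨le_antisymm h2 (h1.trans h3), le_antisymm h1 (h3.trans h2)⟩

end PL

/-- **Equivalence of denotational and game semantics of pLμ on arbitrary models.**
For every PLTS, every pLμ formula `F` in normal form, every interpretation `ρ` and
every process state `p`, the denotational value `⟦F⟧ρ(p)` coincides with the lower
and the upper value of the game `𝒢^F_ρ` at the state `⟨p, F⟩`; in particular the
game is determined at `⟨p, F⟩`. -/
theorem denotational_eq_game_semantics {L P : Type} [Countable L]
    (M : PLTS L P) (F : pLmu L) (hF : F.NormalForm)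
    (ρ : ℕ → P → unitInterval) (p : P) :
    (pLmu.sem M F ρ p : ℝ) =
        lowerValue (gameArena M F) (gamePri F) (gameR F ρ) (Sum.inl p, F) ∧
      lowerValue (gameArena M F) (gamePri F) (gameR F ρ) (Sum.inl p, F) =
        upperValue (gameArena M F) (gamePri F) (gameR F ρ) (Sum.inl p, F) := by
  exact PL.final M F hF ρ p
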